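/- arXiv:2408.15361 — 6 statements merged into one kernel-verified Lean document; each statement's English description precedes it below -/
import Mathlib

section
/- Let A be a d×d real matrix with det A = 1 such that no row of A is an integer vector (i.e. for every row of A at least one entry is not an integer). Then there exists a nonzero x ∈ ℤ^d such that ‖Ax‖_∞ < 1. -/
theorem exists_prime_index (G : Type*) [AddCommGroup G] [Finite G] [Nontrivial G] :
    ∃ S : AddSubgroup G, S.index.Prime := by
  obtain ⟨S, hS⟩ := IsCoatomic.exists_coatom (α := Submodule ℤ G)
  refine ⟨S.toAddSubgroup, ?_⟩
  have := isSimpleModule_iff_isCoatom.2 hS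
  have h2 : IsSimpleAddGroup (G ⧸ S) := by
    have := IsSimpleModule.nontrivial ℤ (G ⧸ S)
    refine ⟨fun H _ => ?_⟩
    rcases eq_bot_or_eq_top (AddSubgroup.toIntSubmodule H) with h | h
    · left; simpa using h
    · right; simpa using h
  exact h2.prime_card

theorem AddSubgroup.exists_prime_relIndex {A : Type*} [AddCommGroup A] (K Y : AddSubgroup A)
    (h0 : K.relIndex Y ≠ 0) (h : ¬ Y ≤ K) :
    ∃ Y' ≤ Y, K ⊓ Y ≤ Y' ∧ (Y'.relIndex Y).Prime := by
  have : Finite (Y ⧸ K.addSubgroupOf Y) := Nat.finite_of_card_ne_zero h0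
  have : Nontrivial (Y ⧸ K.addSubgroupOf Y) := by
    rw [QuotientAddGroup.nontrivial_iff]
    simpa using h
  obtain ⟨S, hS⟩ := exists_prime_index (Y ⧸ K.addSubgroupOf Y)
  refine ⟨(S.comap (QuotientAddGroup.mk' _)).map Y.subtype, AddSubgroup.map_subtype_le _, ?_, ?_⟩
  · rintro x ⟨hx, hxY⟩
    refine ⟨⟨x, hxY⟩, ?_, rfl⟩
    have : ((⟨x, hxY⟩ : Y) : Y ⧸ K.addSubgroupOf Y) = 0 := by
      rw [QuotientAddGroup.eq_zero_iff]; exact hx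
    simp [this]
  · rw [AddSubgroup.relIndex, AddSubgroup.addSubgroupOf, AddSubgroup.comap_map_eq_self_of_injective
      Y.subtype_injective, AddSubgroup.index_comap_of_surjective _ (QuotientAddGroup.mk'_surjective _)]
    exact hS

/-- A set `D` that is a union of cosets of a finite-index subgroup `N`, such that every coset of a
subgroup `Y` not contained in `N` contains a coset of a prime-index subgroup of `Y` missing `D`. -/
structure IsPiece {A : Type*} [AddCommGroup A] (N : AddSubgroup A) (D : Set A) : Prop where
  index_ne_zero : N.index ≠ 0
  mem_of_add_mem : ∀ x, ∀ z ∈ N, x + z ∈ D → x ∈ D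
  exists_coset : ∀ (Y : AddSubgroup A) (x : A), ¬ Y ≤ N →
    ∃ Y' ≤ Y, (Y'.relIndex Y).Prime ∧ ∃ y ∈ Y, ∀ z ∈ Y', x + y + z ∉ D

theorem exists_irredundant_subcover {ι α : Type*} [DecidableEq ι] (U : Finset ι) (D : ι → Set α)
    (B : Set α) (hcov : ∀ x ∈ B, ∃ i ∈ U, x ∈ D i) :
    ∃ V ⊆ U, (∀ x ∈ B, ∃ i ∈ V, x ∈ D i) ∧
      ∀ i ∈ V, ∃ x ∈ B, ∀ j ∈ V, x ∈ D j → j = i := by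
  induction U using Finset.strongInduction with
  | H U ih =>
    by_cases h : ∀ i ∈ U, ∃ x ∈ B, ∀ j ∈ U, x ∈ D j → j = i
    · exact ⟨U, subset_rfl, hcov, h⟩
    · push Not at h
      obtain ⟨i, hi, h⟩ := h
      obtain ⟨V, hVU, hV⟩ := ih (U.erase i) (Finset.erase_ssubset hi) fun x hx => by
        obtain ⟨j, hj, hxj, hji⟩ := h x hx
        exact ⟨j, Finset.mem_erase.2 ⟨hji, hj⟩, hxj⟩
      exact ⟨V, hVU.trans (Finset.erase_subset _ _), hV⟩

namespace IsPiece

variable {A ι : Type*} [AddCommGroup A] {N : ι → AddSubgroup A} {D : ι → Set A}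

theorem finset_inf_index_ne_zero {U : Finset ι} (h : ∀ i ∈ U, IsPiece (N i) (D i)) :
    (U.inf N).index ≠ 0 := by
  classical
  induction U using Finset.induction with
  | empty => simp
  | insert a s ha ih =>
    rw [Finset.inf_insert]
    exact AddSubgroup.index_inf_ne_zero (h a (by simp)).index_ne_zero
      (ih fun i hi => h i (Finset.mem_insert_of_mem hi))

theorem finset_inf_relIndex_ne_zero {U : Finset ι} (h : ∀ i ∈ U, IsPiece (N i) (D i))
    (Y : AddSubgroup A) : (U.inf N).relIndex Y ≠ 0 :=
  fun h0 => finset_inf_index_ne_zero h (Nat.eq_zero_of_zero_dvd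
    (h0 ▸ AddSubgroup.relIndex_dvd_index_of_normal _ _))

open ArithmeticFunction in
theorem cardFactors_relIndex_inf {K Y Z : AddSubgroup A} (hZ : Z ≤ Y) (h1 : K.relIndex Z ≠ 0)
    (h2 : Z.relIndex Y ≠ 0) :
    cardFactors (K.relIndex Y) ≤ cardFactors (K.relIndex Z) + cardFactors (Z.relIndex Y) := by
  rw [← cardFactors_mul h1 h2]
  have h3 : (K ⊓ Z).relIndex Y = K.relIndex Z * Z.relIndex Y := by
    rw [← AddSubgroup.relIndex_inf_mul_relIndex, inf_eq_left.2 hZ]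
  rw [← h3]
  have h4 : (K ⊓ Z).relIndex Y ≠ 0 := by rw [h3]; exact mul_ne_zero h1 h2
  obtain ⟨c, hc⟩ := AddSubgroup.relIndex_dvd_of_le_left Y (inf_le_left : K ⊓ Z ≤ K)
  rw [hc] at h4 ⊢
  rw [cardFactors_mul (left_ne_zero_of_mul h4) (right_ne_zero_of_mul h4)]
  omega

open ArithmeticFunction in
/-- An irredundant cover of a coset of `Y` by `n` pieces has a common invariance subgroup whose
index in `Y` is a product of fewer than `n` primes. -/
theorem cardFactors_lt_of_irredundant [DecidableEq ι] (U : Finset ι) (Y : AddSubgroup A) (x : A)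
    (h : ∀ i ∈ U, IsPiece (N i) (D i)) (hcov : ∀ y ∈ Y, ∃ i ∈ U, x + y ∈ D i)
    (hirr : ∀ i ∈ U, ∃ y ∈ Y, ∀ j ∈ U, x + y ∈ D j → j = i) :
    cardFactors ((U.inf N).relIndex Y) < U.card := by
  induction U using Finset.strongInduction generalizing Y x with
  | H U ih =>
  have sub : ∀ (V : Finset ι) (Y : AddSubgroup A) (x : A), V ⊂ U →
      (∀ y ∈ Y, ∃ i ∈ V, x + y ∈ D i) →
      ∃ W ⊆ V, W.Nonempty ∧ cardFactors ((W.inf N).relIndex Y) < W.card := by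
    intro V Y x hV hc
    obtain ⟨W, hWV, hW, hW'⟩ := exists_irredundant_subcover V (fun i => {y | x + y ∈ D i}) Y hc
    obtain ⟨i, hi, -⟩ := hW 0 Y.zero_mem
    exact ⟨W, hWV, ⟨i, hi⟩, ih W (hWV.trans_ssubset hV) Y x
      (fun i hi => h i (hV.1 (hWV hi))) hW hW'⟩
  have hUne : U.Nonempty := by
    obtain ⟨i, hi, -⟩ := hcov 0 Y.zero_mem
    exact ⟨i, hi⟩
  by_cases hall : Y ≤ U.inf N
  · rw [AddSubgroup.relIndex_eq_one.2 hall]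
    simpa using hUne
  obtain ⟨i, hi, hYi⟩ : ∃ i ∈ U, ¬ Y ≤ N i := by
    by_contra! hcon
    exact hall (Finset.le_inf hcon)
  obtain ⟨Y', hY'Y, hpr, y, hy, hdis⟩ := (h i hi).exists_coset Y x hYi
  obtain ⟨W, hWU, hWne, hW⟩ := sub (U.erase i) Y' (x + y) (Finset.erase_ssubset hi) fun z hz => by
    obtain ⟨j, hj, hxj⟩ := hcov (y + z) (Y.add_mem hy (hY'Y hz))
    rw [← add_assoc] at hxj
    refine ⟨j, Finset.mem_erase.2 ⟨?_, hj⟩, hxj⟩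
    rintro rfl
    exact hdis z hz hxj
  have hiW : i ∉ W := fun hh => by simpa using hWU hh
  have hWU' : W ⊆ U := hWU.trans (Finset.erase_subset _ _)
  have hWb : cardFactors ((W.inf N).relIndex Y) ≤ W.card := by
    have := cardFactors_relIndex_inf (K := W.inf N) hY'Y
      (finset_inf_relIndex_ne_zero (fun i hi => h i (hWU' hi)) _) hpr.ne_zero
    rw [cardFactors_apply_prime hpr] at this
    omega
  have ext : ∀ V ⊂ U, V.Nonempty → ∃ W ⊆ U, V ⊂ W ∧
      cardFactors ((W.inf N).relIndex Y) + V.card + 1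
        ≤ cardFactors ((V.inf N).relIndex Y) + W.card := by
    intro V hVU hVne
    obtain ⟨r, hrU, hrV⟩ := Finset.exists_of_ssubset hVU
    obtain ⟨y, hy, hyr⟩ := hirr r hrU
    obtain ⟨R, hRU, hRne, hR⟩ := sub (U \ V) (Y ⊓ V.inf N) (x + y)
      (Finset.sdiff_ssubset hVU.1 hVne) fun z hz => by
        obtain ⟨j, hj, hxj⟩ := hcov (y + z) (Y.add_mem hy hz.1)
        rw [← add_assoc] at hxj
        refine ⟨j, Finset.mem_sdiff.2 ⟨hj, fun hjV => ?_⟩, hxj⟩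
        have hz2 : z ∈ N j := (Finset.inf_le hjV : V.inf N ≤ N j) hz.2
        have := hyr j hj ((h j hj).mem_of_add_mem _ z hz2 hxj)
        exact hrV (this ▸ hjV)
    have hdisj : Disjoint V R := Finset.disjoint_of_subset_right hRU Finset.disjoint_sdiff
    refine ⟨V ∪ R, Finset.union_subset hVU.1 (hRU.trans Finset.sdiff_subset), ?_, ?_⟩
    · refine Finset.ssubset_iff_subset_ne.2 ⟨Finset.subset_union_left, fun heq => ?_⟩
      obtain ⟨s, hs⟩ := hRne
      exact Finset.disjoint_left.1 hdisj (heq ▸ Finset.mem_union_right V hs) hs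
    · rw [Finset.card_union_of_disjoint hdisj]
      have hUn : ∀ i ∈ V ∪ R, IsPiece (N i) (D i) := fun i hi => h i
        ((Finset.union_subset hVU.1 (hRU.trans Finset.sdiff_subset)) hi)
      have e : ((V ∪ R).inf N).relIndex (Y ⊓ V.inf N) = (R.inf N).relIndex (Y ⊓ V.inf N) := by
        rw [Finset.inf_union, ← AddSubgroup.inf_relIndex_right,
          ← AddSubgroup.inf_relIndex_right (R.inf N)]
        congr 1
        ext z; simp only [AddSubgroup.mem_inf]; tauto
      have := cardFactors_relIndex_inf (K := (V ∪ R).inf N) (Y := Y) (Z := Y ⊓ V.inf N)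
        inf_le_left (finset_inf_relIndex_ne_zero hUn _) (by
          rw [AddSubgroup.inf_relIndex_left]
          exact finset_inf_relIndex_ne_zero (fun i hi => h i (hVU.1 hi)) _)
      rw [AddSubgroup.inf_relIndex_left, e] at this
      omega
  have grow : ∀ n : ℕ, ∀ V ⊆ U, (U \ V).card = n → V.Nonempty →
      (cardFactors ((V.inf N).relIndex Y) < V.card ∨
        V ≠ U ∧ cardFactors ((V.inf N).relIndex Y) ≤ V.card) →
      cardFactors ((U.inf N).relIndex Y) < U.card := by
    intro n
    induction n using Nat.strong_induction_on with
    | _ n ihn =>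
    intro V hVU hn hVne hV
    by_cases hVeq : V = U
    · subst hVeq
      simpa using hV
    obtain ⟨W, hWU, hVW, hb⟩ := ext V (Finset.ssubset_iff_subset_ne.2 ⟨hVU, hVeq⟩) hVne
    refine ihn _ ?_ W hWU rfl (hVne.mono hVW.1) (Or.inl (by omega))
    rw [← hn]
    have h1 := Finset.card_sdiff_add_card_eq_card hVU
    have h2 := Finset.card_sdiff_add_card_eq_card hWU
    have h3 := Finset.card_lt_card hVW
    omega
  exact grow _ W hWU' rfl hWne (Or.inr ⟨fun hh => hiW (hh ▸ hi), hWb⟩)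

end IsPiece

section PrimeOrder

variable {A ι : Type*} [AddCommGroup A]

/-- The elements at which a real-valued additive map takes an integral value. -/
def integralSubgroup (f : A →+ ℝ) : AddSubgroup A := (Int.castAddHom ℝ).range.comap f

/-- The elements at which a real-valued additive map has order `p` modulo `ℤ`. -/
def primeOrderSet (p : ℕ) (f : A →+ ℝ) : Set A :=
  {x | x ∉ integralSubgroup f ∧ x ∈ integralSubgroup (p • f)}

theorem isPiece_subgroup {K : AddSubgroup A} (hK : K.index ≠ 0) : IsPiece K (K : Set A) where
  index_ne_zero := hK
  mem_of_add_mem x z hz hxz := (K.add_mem_cancel_right hz).1 hxz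
  exists_coset Y x hY := by
    obtain ⟨Y', hY', hle, hpr⟩ := K.exists_prime_relIndex Y
      (fun h0 => hK (Nat.eq_zero_of_zero_dvd (h0 ▸ K.relIndex_dvd_index_of_normal _))) hY
    refine ⟨Y', hY', hpr, ?_⟩
    by_cases hx : ∃ y ∈ Y, x + y ∈ K
    · obtain ⟨y, hy, hxy⟩ := hx
      obtain ⟨u, hu, hu'⟩ : ∃ u ∈ Y, u ∉ Y' := by
        by_contra! hcon
        exact hpr.ne_one (AddSubgroup.relIndex_eq_one.2 hcon)
      refine ⟨y + u, Y.add_mem hy hu, fun z hz hmem => hu' ?_⟩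
      have h1 : u + z ∈ K := by
        have := K.sub_mem hmem hxy
        rwa [show x + (y + u) + z - (x + y) = u + z by abel] at this
      have h2 := hle ⟨h1, Y.add_mem hu (hY' hz)⟩
      exact (Y'.add_mem_cancel_right hz).1 h2
    · push Not at hx
      exact ⟨0, Y.zero_mem, fun z hz => by simpa using hx z (hY' hz)⟩

theorem exists_zsmul_add_mem_integralSubgroup {p : ℕ} (hp : p.Prime) {f : A →+ ℝ} {u v : A}
    (hu : u ∈ primeOrderSet p f) (hv : v ∈ integralSubgroup (p • f)) :
    ∃ k : ℤ, v + k • u ∈ integralSubgroup f := by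
  obtain ⟨hu1, a, ha⟩ := hu
  obtain ⟨b, hb⟩ := hv
  have hp0 : (p : ℝ) ≠ 0 := by exact_mod_cast hp.ne_zero
  simp only [Int.coe_castAddHom, AddMonoidHom.smul_apply, nsmul_eq_mul] at ha hb
  have hpa : ¬ (p : ℤ) ∣ a := by
    rintro ⟨c, rfl⟩
    refine hu1 ⟨c, ?_⟩
    push_cast at ha
    exact mul_left_cancel₀ hp0 ha
  have hcop : IsCoprime (p : ℤ) a := (Nat.prime_iff_prime_int.1 hp).coprime_iff_not_dvd.2 hpa
  obtain ⟨r, s, hrs⟩ := hcop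
  refine ⟨-(b * s), b * r, ?_⟩
  have hrs' : (r : ℝ) * p + s * a = 1 := by exact_mod_cast hrs
  apply mul_left_cancel₀ hp0
  simp only [Int.coe_castAddHom, Int.cast_mul, map_add, map_zsmul, zsmul_eq_mul, Int.cast_neg]
  linear_combination (b : ℝ) * hrs' - (b : ℝ) * s * ha + hb

theorem integralSubgroup_le_nsmul (n : ℕ) (f : A →+ ℝ) :
    integralSubgroup f ≤ integralSubgroup (n • f) := by
  rintro x ⟨m, hm⟩
  refine ⟨n * m, ?_⟩
  simp only [Int.coe_castAddHom] at hm
  simp [hm]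

theorem isPiece_primeOrderSet {p : ℕ} (hp : p.Prime) {f : A →+ ℝ}
    (hf : (integralSubgroup f).index ≠ 0) : IsPiece (integralSubgroup f) (primeOrderSet p f) where
  index_ne_zero := hf
  mem_of_add_mem x z hz hxz :=
    ⟨fun hx => hxz.1 (AddSubgroup.add_mem _ hx hz),
      (AddSubgroup.add_mem_cancel_right _ (integralSubgroup_le_nsmul p f hz)).1 hxz.2⟩
  exists_coset Y x hY := by
    have rel : ∀ K : AddSubgroup A, integralSubgroup f ≤ K → K.relIndex Y ≠ 0 := fun K hK h0 =>
      hf (Nat.eq_zero_of_zero_dvd (h0 ▸ (K.relIndex_dvd_index_of_normal Y).trans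
        (AddSubgroup.index_dvd_of_le hK)))
    obtain ⟨Y', hY', hle, hpr⟩ := (integralSubgroup f).exists_prime_relIndex Y (rel _ le_rfl) hY
    by_cases hx : ∃ y ∈ Y, x + y ∈ primeOrderSet p f
    swap
    · push Not at hx
      exact ⟨Y', hY', hpr, 0, Y.zero_mem, fun z hz => by simpa using hx z (hY' hz)⟩
    obtain ⟨y, hy, hxy⟩ := hx
    by_cases hYp : Y ≤ integralSubgroup (p • f)
    · refine ⟨Y', hY', hpr, ?_⟩
      have hY'f : Y' ≤ integralSubgroup f := by
        intro u hu
        by_contra hu'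
        refine hpr.ne_one (AddSubgroup.relIndex_eq_one.2 fun v hv => ?_)
        obtain ⟨k, hk⟩ := exists_zsmul_add_mem_integralSubgroup hp ⟨hu', hYp (hY' hu)⟩ (hYp hv)
        exact (Y'.add_mem_cancel_right (Y'.zsmul_mem hu k)).1
          (hle ⟨hk, Y.add_mem hv (Y.zsmul_mem (hY' hu) k)⟩)
      obtain ⟨u, hu, hu'⟩ := SetLike.not_le_iff_exists.1 hY
      obtain ⟨k, hk⟩ := exists_zsmul_add_mem_integralSubgroup hp ⟨hu', hYp hu⟩ hxy.2
      refine ⟨y + k • u, Y.add_mem hy (Y.zsmul_mem hu k), fun z hz hmem => hmem.1 ?_⟩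
      rw [← add_assoc]
      exact AddSubgroup.add_mem _ hk (hY'f hz)
    · obtain ⟨Y₂, hY₂, hle₂, hpr₂⟩ := (integralSubgroup (p • f)).exists_prime_relIndex Y
        (rel _ (integralSubgroup_le_nsmul p f)) hYp
      obtain ⟨u, hu, hu'⟩ : ∃ u ∈ Y, u ∉ Y₂ := by
        by_contra! hcon
        exact hpr₂.ne_one (AddSubgroup.relIndex_eq_one.2 hcon)
      refine ⟨Y₂, hY₂, hpr₂, y + u, Y.add_mem hy hu, fun z hz hmem => hu' ?_⟩
      have h1 := AddSubgroup.sub_mem _ hmem.2 hxy.2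
      rw [show x + (y + u) + z - (x + y) = u + z by abel] at h1
      exact (Y₂.add_mem_cancel_right hz).1 (hle₂ ⟨h1, Y.add_mem hu (hY₂ hz)⟩)

open ArithmeticFunction

theorem cardFactors_relIndex_le_of_cover [DecidableEq ι] (S : Finset ι) {p : ι → ℕ}
    (hp : ∀ i, (p i).Prime) {f : ι → A →+ ℝ} {Q : AddSubgroup A} (hQ : Q.index ≠ 0)
    (hQN : ∀ i ∈ S, Q ≤ integralSubgroup (f i)) (Y : AddSubgroup A)
    (hcov : ∀ y ∈ Y, y ∉ Q → ∃ i ∈ S, y ∈ primeOrderSet (p i) (f i)) :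
    cardFactors (Q.relIndex Y) ≤ S.card := by
  let N : Option ι → AddSubgroup A := fun o => o.elim Q fun i => integralSubgroup (f i)
  let D : Option ι → Set A := fun o => o.elim (Q : Set A) fun i => primeOrderSet (p i) (f i)
  have hpiece : ∀ o ∈ S.insertNone, IsPiece (N o) (D o) := by
    rintro (_ | i) ho
    · exact isPiece_subgroup hQ
    · exact isPiece_primeOrderSet (hp i) fun h0 =>
        hQ (Nat.eq_zero_of_zero_dvd (h0 ▸ AddSubgroup.index_dvd_of_le (hQN i (by simpa using ho))))
  obtain ⟨V, hVS, hV, hV'⟩ := exists_irredundant_subcover S.insertNone D Y (by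
    intro y hy
    by_cases hyQ : y ∈ Q
    · exact ⟨none, by simp, hyQ⟩
    · obtain ⟨i, hi, hyi⟩ := hcov y hy hyQ
      exact ⟨some i, by simpa using hi, hyi⟩)
  have hlt := IsPiece.cardFactors_lt_of_irredundant V Y 0 (fun o ho => hpiece o (hVS ho))
    (by simpa using hV) (by simpa using hV')
  have hnone : none ∈ V := by
    obtain ⟨o, ho, h0⟩ := hV 0 Y.zero_mem
    cases o with
    | none => exact ho
    | some i => exact absurd (AddSubgroup.zero_mem _) h0.1
  have hinf : V.inf N = Q := by
    refine le_antisymm (Finset.inf_le hnone) (Finset.le_inf ?_)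
    rintro (_ | i) ho
    · exact le_rfl
    · exact hQN i (by simpa using hVS ho)
  rw [hinf] at hlt
  have := Finset.card_le_card hVS
  rw [Finset.card_insertNone] at this
  omega

/-- **Hajós' theorem** for prime factors, in covering form. -/
theorem exists_integralSubgroup_eq_top [DecidableEq ι] (S : Finset ι) (hS : S.Nonempty) {p : ι → ℕ}
    (hp : ∀ i, (p i).Prime) {f : ι → A →+ ℝ} {Q : AddSubgroup A} (hQ : Q.index ≠ 0)
    (hQN : ∀ i ∈ S, Q ≤ integralSubgroup (f i))
    (hcov : ∀ x, x ∉ Q → ∃ i ∈ S, x ∈ primeOrderSet (p i) (f i))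
    (hcard : S.card ≤ cardFactors Q.index) :
    ∃ i ∈ S, integralSubgroup (p i • f i) = ⊤ := by
  induction S using Finset.strongInduction generalizing Q with
  | H S ih =>
  obtain ⟨i₀, hi₀⟩ := hS
  let M := integralSubgroup (p i₀ • f i₀)
  have hNi : ∀ i ∈ S, (integralSubgroup (f i)).index ≠ 0 := fun i hi h0 =>
    hQ (Nat.eq_zero_of_zero_dvd (h0 ▸ AddSubgroup.index_dvd_of_le (hQN i hi)))
  have hM : M.index ≠ 0 := fun h0 => hNi i₀ hi₀ (Nat.eq_zero_of_zero_dvd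
    (h0 ▸ AddSubgroup.index_dvd_of_le (integralSubgroup_le_nsmul (p i₀) (f i₀))))
  let N : Option ι → AddSubgroup A := fun o => o.elim M fun i => integralSubgroup (f i)
  let D : Option ι → Set A := fun o => o.elim (M : Set A) fun i => primeOrderSet (p i) (f i)
  have hpiece : ∀ o ∈ S.insertNone, IsPiece (N o) (D o) := by
    rintro (_ | i) ho
    · exact isPiece_subgroup hM
    · exact isPiece_primeOrderSet (hp i) (hNi i (by simpa using ho))
  obtain ⟨V, hVS, hV, hV'⟩ := exists_irredundant_subcover (S.erase i₀).insertNone D Set.univ (by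
    intro x _
    by_cases hxM : x ∈ M
    · exact ⟨none, by simp, hxM⟩
    · obtain ⟨i, hi, hxi⟩ := hcov x fun hxQ =>
        hxM (integralSubgroup_le_nsmul _ _ (hQN i₀ hi₀ hxQ))
      refine ⟨some i, ?_, hxi⟩
      have : i ≠ i₀ := by rintro rfl; exact hxM hxi.2
      simpa using ⟨this, hi⟩)
  have hVS' : V ⊆ S.insertNone :=
    hVS.trans (Finset.insertNone.monotone (Finset.erase_subset _ _))
  have hnone : none ∈ V := by
    obtain ⟨o, ho, h0⟩ := hV 0 trivial
    cases o with
    | none => exact ho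
    | some i => exact absurd (AddSubgroup.zero_mem _) h0.1
  obtain ⟨T, rfl⟩ : ∃ T : Finset ι, V = T.insertNone :=
    ⟨V.eraseNone, by rw [Finset.insertNone_eraseNone, Finset.insert_eq_self.2 hnone]⟩
  have hTS : T ⊆ S.erase i₀ := fun i hi => by simpa using hVS (Finset.some_mem_insertNone.2 hi)
  have hTS' : T ⊂ S := hTS.trans_ssubset (Finset.erase_ssubset hi₀)
  by_cases hT : T = ∅
  · subst hT
    refine ⟨i₀, hi₀, eq_top_iff.2 fun x _ => ?_⟩
    obtain ⟨o, ho, hx⟩ := hV x trivial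
    cases o with
    | none => exact hx
    | some i => simp at ho
  have hlt := IsPiece.cardFactors_lt_of_irredundant T.insertNone ⊤ (0 : A)
    (fun o ho => hpiece o (hVS' ho)) (by simpa using hV) (by simpa using hV')
  let N' : ι → AddSubgroup A := fun i => integralSubgroup (f i)
  let D' : ι → Set A := fun i => primeOrderSet (p i) (f i)
  have hpiece' : ∀ i ∈ S, IsPiece (N' i) (D' i) := fun i hi =>
    isPiece_primeOrderSet (hp i) (hNi i hi)
  let Y := T.inf N'
  have hY0 : Y.index ≠ 0 := IsPiece.finset_inf_index_ne_zero fun i hi => hpiece' i (hTS'.1 hi)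
  have hQY : Q ≤ Y := Finset.le_inf fun i hi => hQN i (hTS'.1 hi)
  have hYT : cardFactors Y.index ≤ T.card := by
    have hle : T.insertNone.inf N ≤ Y := Finset.le_inf fun i hi =>
      (Finset.inf_le (Finset.some_mem_insertNone.2 hi) : T.insertNone.inf N ≤ N (some i))
    rw [AddSubgroup.relIndex_top_right, Finset.card_insertNone] at hlt
    obtain ⟨c, hc⟩ := AddSubgroup.index_dvd_of_le hle
    have h0 : (T.insertNone.inf N).index ≠ 0 :=
      IsPiece.finset_inf_index_ne_zero fun o ho => hpiece o (hVS' ho)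
    rw [hc] at h0 hlt
    rw [cardFactors_mul (left_ne_zero_of_mul h0) (right_ne_zero_of_mul h0)] at hlt
    omega
  have hrel : ∀ Z : AddSubgroup A, Q.relIndex Z ≠ 0 := fun Z h0 =>
    hQ (Nat.eq_zero_of_zero_dvd (h0 ▸ Q.relIndex_dvd_index_of_normal Z))
  have hQsplit : cardFactors Q.index = cardFactors (Q.relIndex Y) + cardFactors Y.index := by
    rw [← cardFactors_mul (hrel Y) hY0, AddSubgroup.relIndex_mul_index hQY]
  have hpack : ∀ R ⊆ S, cardFactors (Q.relIndex (R.inf N')) + R.card ≤ S.card := by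
    intro R hR
    have := cardFactors_relIndex_le_of_cover (S \ R) hp hQ
      (fun i hi => hQN i (Finset.mem_sdiff.1 hi).1) (R.inf N') fun y hy hyQ => by
        obtain ⟨i, hi, hyi⟩ := hcov y hyQ
        refine ⟨i, Finset.mem_sdiff.2 ⟨hi, fun hiR => hyi.1 ?_⟩, hyi⟩
        exact (Finset.inf_le hiR : R.inf N' ≤ N' i) hy
    have h2 := Finset.card_sdiff_add_card_eq_card hR
    omega
  have hpackT : cardFactors (Q.relIndex Y) + T.card ≤ S.card := hpack T hTS'.1
  obtain ⟨i, hi, htop⟩ := ih T hTS' (Finset.nonempty_iff_ne_empty.2 hT) hY0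
    (fun i hi => Finset.inf_le hi) (by
      intro x hxY
      by_contra! hcon
      obtain ⟨R, hRS, hR, hR'⟩ := exists_irredundant_subcover (S \ T) (fun i => {y | x + y ∈ D' i})
        Y (by
          intro y hy
          obtain ⟨i, hi, hxi⟩ := hcov (x + y) fun hxy =>
            hxY ((Y.add_mem_cancel_right hy).1 (hQY hxy))
          refine ⟨i, Finset.mem_sdiff.2 ⟨hi, fun hiT => hcon i hiT ?_⟩, hxi⟩
          exact (hpiece' i hi).mem_of_add_mem x y ((Finset.inf_le hiT : Y ≤ N' i) hy) hxi)
      have hRS' : R ⊆ S := hRS.trans Finset.sdiff_subset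
      have h1 := IsPiece.cardFactors_lt_of_irredundant R Y x (fun i hi => hpiece' i (hRS' hi)) hR hR'
      have h2 := hpack (T ∪ R) (Finset.union_subset hTS'.1 hRS')
      rw [Finset.card_union_of_disjoint
        (Finset.disjoint_of_subset_right hRS Finset.disjoint_sdiff), Finset.inf_union] at h2
      have h3 := IsPiece.cardFactors_relIndex_inf (K := Q) (Y := Y) (Z := T.inf N' ⊓ R.inf N')
        inf_le_left (hrel _) (by
          rw [AddSubgroup.inf_relIndex_left]
          exact IsPiece.finset_inf_relIndex_ne_zero (fun i hi => hpiece' i (hRS' hi)) _)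
      rw [AddSubgroup.inf_relIndex_left] at h3
      change _ ≤ _ + cardFactors ((R.inf N').relIndex Y) at h3
      omega) (by omega)
  exact ⟨i, hTS'.1 hi, htop⟩

end PrimeOrder
section RationalMatrix

open ArithmeticFunction Matrix

theorem exists_intMatrix_eq_smul {m n : Type*} [Fintype m] [Fintype n] (M : Matrix m n ℚ) :
    ∃ q : ℕ, 1 < q ∧ ∃ E : Matrix m n ℤ, E.map (Int.cast : ℤ → ℚ) = (q : ℚ) • M := by
  classical
  let q := 2 * ∏ i, ∏ j, (M i j).den
  have hq0 : 0 < ∏ i, ∏ j, (M i j).den :=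
    Finset.prod_pos fun i _ => Finset.prod_pos fun j _ => (M i j).den_pos
  have hdvd : ∀ i j, (M i j).den ∣ q := fun i j =>
    (((Finset.dvd_prod_of_mem _ (Finset.mem_univ j)).trans
      (Finset.dvd_prod_of_mem (fun i => ∏ j, (M i j).den) (Finset.mem_univ i))).mul_left 2)
  refine ⟨q, by omega, Matrix.of fun i j => (M i j).num * (q / (M i j).den : ℕ), ?_⟩
  ext i j
  obtain ⟨c, hc⟩ := hdvd i j
  have hd := (M i j).den_pos
  have hd' : ((M i j).den : ℚ) ≠ 0 := by exact_mod_cast hd.ne'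
  simp only [Matrix.map_apply, Matrix.of_apply, Matrix.smul_apply, smul_eq_mul]
  rw [hc, Nat.mul_div_cancel_left _ hd]
  push_cast
  nth_rw 3 [← Rat.num_div_den (M i j)]
  field_simp

theorem index_range_mulVec {n : Type*} [Fintype n] [DecidableEq n] (E : Matrix n n ℤ)
    (hE : E.det ≠ 0) :
    (LinearMap.range (Matrix.toLin' E)).toAddSubgroup.index = E.det.natAbs := by
  have hinj : Function.Injective (Matrix.toLin' E) := by
    rw [Matrix.toLin'_apply']
    exact Matrix.mulVec_injective_of_det_ne_zero hE
  have h := Submodule.natAbs_det_equiv (LinearMap.range (Matrix.toLin' E))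
    (LinearEquiv.ofInjective _ hinj)
  rw [AddSubgroup.index, ← LinearMap.det_toLin' E]
  exact h.symm

theorem exists_take_prod_step (L : List ℕ) (g : ℝ) (h0 : ¬ ∃ n : ℤ, (n : ℝ) = g)
    (h1 : ∃ n : ℤ, (n : ℝ) = L.prod * g) :
    ∃ t : Fin L.length, (¬ ∃ n : ℤ, (n : ℝ) = (L.take t).prod * g) ∧
      ∃ n : ℤ, (n : ℝ) = L[t] * ((L.take t).prod * g) := by
  by_contra! hcon
  have : ∀ k ≤ L.length, ¬ ∃ n : ℤ, (n : ℝ) = (L.take k).prod * g := by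
    intro k
    induction k with
    | zero => intro _; simpa using h0
    | succ k ih =>
      rintro hk ⟨n, hn⟩
      refine hcon ⟨k, hk⟩ (by simpa using ih (by omega)) n ?_
      rw [hn, List.prod_take_succ L k hk]
      push_cast
      simp only [Fin.getElem_fin]
      ring
  exact this _ le_rfl (by simpa using h1)

/-- The `i`-th linear form of a real matrix, scaled by `c`, on integer vectors. -/
def scaledForm {d : ℕ} (B : Matrix (Fin d) (Fin d) ℝ) (c : ℝ) (i : Fin d) :
    (Fin d → ℤ) →+ ℝ where
  toFun x := c * (B *ᵥ fun j => (x j : ℝ)) i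
  map_zero' := by simp [Matrix.mulVec, dotProduct]
  map_add' x y := by
    simp [Matrix.mulVec, dotProduct, mul_add, Finset.sum_add_distrib]

theorem exists_integer_row_of_rational {d : ℕ} (hd : 0 < d) (B : Matrix (Fin d) (Fin d) ℚ)
    (hdet : B.det = 1)
    (hB : ∀ x : Fin d → ℤ, x ≠ 0 → ∃ i, ∃ n : ℤ, n ≠ 0 ∧
      (B.map (Rat.cast : ℚ → ℝ) *ᵥ fun j => (x j : ℝ)) i = n) :
    ∃ i, ∀ j, ∃ z : ℤ, B i j = z := by
  obtain ⟨q, hq, E, hE⟩ := exists_intMatrix_eq_smul B⁻¹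
  have hq0 : (q : ℝ) ≠ 0 := by positivity
  have hBE : ∀ z : Fin d → ℤ, (B.map (Rat.cast : ℚ → ℝ) *ᵥ fun j => ((E *ᵥ z) j : ℝ)) =
      fun i => (q : ℝ) * z i := by
    intro z
    have h1 : B * E.map (Int.cast : ℤ → ℚ) = (q : ℚ) • (1 : Matrix _ _ ℚ) := by
      rw [hE, Matrix.mul_smul, Matrix.mul_nonsing_inv _ (by rw [hdet]; exact isUnit_one)]
    have h2 : B.map (Rat.cast : ℚ → ℝ) * E.map (Int.cast : ℤ → ℝ) = (q : ℝ) • 1 := by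
      have := congrArg (fun M : Matrix (Fin d) (Fin d) ℚ => M.map (Rat.castHom ℝ)) h1
      simp only [Matrix.map_mul, Matrix.map_map] at this
      convert this using 1
      · congr 1
      · ext i j
        simp only [Matrix.smul_apply, Matrix.one_apply, Matrix.map_apply]
        split_ifs <;> simp
    have h3 : (fun j => ((E *ᵥ z) j : ℝ)) = E.map (Int.cast : ℤ → ℝ) *ᵥ fun j => (z j : ℝ) := by
      ext j
      simp [Matrix.mulVec, dotProduct]
    rw [h3, Matrix.mulVec_mulVec, h2]
    ext i
    simp [Matrix.smul_mulVec]
  have hdetE : E.det = (q : ℤ) ^ d := by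
    have h1 : ((E.det : ℤ) : ℚ) = (q : ℚ) ^ d := by
      rw [Int.cast_det]
      change (E.map (Int.cast : ℤ → ℚ)).det = _
      rw [hE, Matrix.det_smul, Matrix.det_nonsing_inv, hdet]
      simp
    exact_mod_cast h1
  let L := q.primeFactorsList
  have hLprod : L.prod = q := Nat.prod_primeFactorsList (by omega)
  let Q := (LinearMap.range (Matrix.toLin' E)).toAddSubgroup
  have hQi : Q.index = q ^ d := by
    rw [index_range_mulVec E (by rw [hdetE]; positivity), hdetE]
    simp [Int.natAbs_pow]
  have hLlen : 0 < L.length := by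
    rw [← cardFactors_apply]
    exact cardFactors_pos_iff_one_lt.2 hq
  obtain ⟨⟨i, t⟩, -, htop⟩ := exists_integralSubgroup_eq_top
    (Finset.univ : Finset (Fin d × Fin L.length)) ⟨(⟨0, hd⟩, ⟨0, hLlen⟩), Finset.mem_univ _⟩
    (p := fun it => L[it.2])
    (fun it => Nat.prime_of_mem_primeFactorsList (List.getElem_mem _))
    (f := fun it => scaledForm (B.map Rat.cast) ((L.take it.2).prod / q) it.1)
    (Q := Q) (by rw [hQi]; positivity) (by
      rintro ⟨i, t⟩ - x ⟨z, rfl⟩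
      refine ⟨(L.take t).prod * z i, ?_⟩
      simp only [scaledForm, AddMonoidHom.coe_mk, ZeroHom.coe_mk, Matrix.toLin'_apply]
      rw [hBE]
      simp only [Int.coe_castAddHom]
      rw [Int.cast_mul, Int.cast_natCast]
      field_simp) (by
      intro x hx
      classical
      let y := B.map (Rat.cast : ℚ → ℝ) *ᵥ fun j => (x j : ℝ)
      let z : Fin d → ℤ := fun i => if h : ∃ n : ℤ, y i = q * n then h.choose else 0
      have hne : x - E *ᵥ z ≠ 0 := by
        intro h0
        exact hx ⟨z, by rw [Matrix.toLin'_apply]; exact (sub_eq_zero.1 h0).symm⟩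
      obtain ⟨i, n, hn0, hn⟩ := hB _ hne
      have hsub : (fun j => (((x - E *ᵥ z) j : ℤ) : ℝ)) =
          (fun j => (x j : ℝ)) - fun j => ((E *ᵥ z) j : ℝ) := by
        ext j; simp
      rw [hsub, Matrix.mulVec_sub, hBE] at hn
      simp only [Pi.sub_apply] at hn
      change y i - q * z i = n at hn
      have hyi : ¬ ∃ n : ℤ, y i = q * n := by
        intro h
        simp only [z, dif_pos h, ← h.choose_spec, sub_self] at hn
        exact hn0 (by exact_mod_cast hn.symm)
      simp only [z, dif_neg hyi] at hn
      obtain ⟨t, ht1, ht2⟩ := exists_take_prod_step L (y i / q)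
        (by
          rintro ⟨m, hm⟩
          exact hyi ⟨m, by rw [hm]; field_simp⟩)
        ⟨n, by rw [hLprod]; push_cast at hn; rw [← hn]; field_simp; simp⟩
      refine ⟨(i, t), Finset.mem_univ _, ?_, ?_⟩
      · rintro ⟨m, hm⟩
        refine ht1 ⟨m, ?_⟩
        simp only [scaledForm, AddMonoidHom.coe_mk, ZeroHom.coe_mk, Int.coe_castAddHom] at hm
        rw [hm]
        change _ / _ * y i = _
        ring
      · obtain ⟨m, hm⟩ := ht2
        refine ⟨m, ?_⟩
        simp only [scaledForm, AddMonoidHom.coe_mk, ZeroHom.coe_mk, Int.coe_castAddHom,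
          AddMonoidHom.smul_apply, nsmul_eq_mul]
        rw [hm]
        change _ = _ * (_ / _ * y i)
        ring) (by
      rw [hQi, cardFactors_pow, cardFactors_apply]
      simp [L])
  refine ⟨i, fun j => ?_⟩
  obtain ⟨n, hn⟩ : (Pi.single j 1 : Fin d → ℤ) ∈ integralSubgroup
      (L[t] • scaledForm (B.map Rat.cast) ((L.take t).prod / q) i) := by
    have h := AddSubgroup.mem_top (Pi.single j 1 : Fin d → ℤ)
    rwa [← htop] at h
  obtain ⟨c, hc⟩ : (L.take t).prod * L[t] ∣ q := by
    rw [Fin.getElem_fin, ← List.prod_take_succ L t t.2]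
    exact ⟨(L.drop (t + 1)).prod, by rw [List.prod_take_mul_prod_drop, hLprod]⟩
  have hs : (fun k => ((Pi.single j 1 : Fin d → ℤ) k : ℝ)) = Pi.single j 1 := by
    ext k
    by_cases hk : k = j
    · subst hk; simp
    · simp [hk]
  simp only [scaledForm, AddMonoidHom.coe_mk, ZeroHom.coe_mk, Int.coe_castAddHom,
    AddMonoidHom.smul_apply, nsmul_eq_mul] at hn
  rw [hs, Matrix.mulVec_single_one] at hn
  refine ⟨c * n, ?_⟩
  have hcR : (q : ℝ) = (L.take t).prod * L[t] * c := by exact_mod_cast hc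
  have : (B i j : ℝ) = c * n := by
    rw [hn]
    simp only [Matrix.col_apply, Matrix.map_apply]
    have e : (c : ℝ) * (L[t] * ((L.take t).prod / q * (B i j : ℝ))) =
      ((L.take t).prod * L[t] * c) / q * B i j := by ring
    rw [e, ← hcR, div_self hq0, one_mul]
  exact_mod_cast this

end RationalMatrix

section CubeTiling

open Matrix MeasureTheory Filter Topology

variable {d : ℕ}

/-- **Blichfeldt's theorem** for the lattice `A ℤᵈ`. -/
theorem exists_sub_eq_mulVec_intCast (A : Matrix (Fin d) (Fin d) ℝ) (hA : A.det ≠ 0)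
    {S : Set (Fin d → ℝ)} (hS : MeasurableSet S) (hvol : ENNReal.ofReal |A.det| < volume S) :
    ∃ s ∈ S, ∃ s' ∈ S, ∃ z : Fin d → ℤ, z ≠ 0 ∧ s - s' = A *ᵥ fun j => (z j : ℝ) := by
  let f := Matrix.toLin' A
  have hf : LinearMap.det f = A.det := LinearMap.det_toLin' A
  have hfm : Measurable f := f.continuous_of_finiteDimensional.measurable
  have hT : volume (ZSpan.fundamentalDomain (Pi.basisFun ℝ (Fin d))) < volume (f ⁻¹' S) := by
    rw [Measure.addHaar_preimage_linearMap _ (by rwa [hf]), hf, ZSpan.fundamentalDomain_pi_basisFun,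
      Real.volume_pi_Ico]
    simp only [sub_zero, ENNReal.ofReal_one, Finset.prod_const_one]
    have h0 : ENNReal.ofReal |A.det| ≠ 0 := by simpa using hA
    rw [abs_inv, ENNReal.ofReal_inv_of_pos (abs_pos.2 hA), mul_comm, ← div_eq_mul_inv]
    rw [ENNReal.lt_div_iff_mul_lt (Or.inl h0) (Or.inl ENNReal.ofReal_ne_top)]
    simpa using hvol
  have : Countable (Submodule.span ℤ (Set.range (Pi.basisFun ℝ (Fin d)))).toAddSubgroup :=
    inferInstanceAs (Countable (Submodule.span ℤ (Set.range (Pi.basisFun ℝ (Fin d)))))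
  obtain ⟨x, y, hxy, h⟩ := exists_pair_mem_lattice_not_disjoint_vadd
    (ZSpan.isAddFundamentalDomain' (Pi.basisFun ℝ (Fin d)) volume)
    (hfm hS).nullMeasurableSet hT
  obtain ⟨w, ⟨s, hs, rfl⟩, ⟨s', hs', hw⟩⟩ := Set.not_disjoint_iff.1 h
  have hcoord : ∀ j, ∃ n : ℤ, (n : ℝ) = ((y - x : _) : Fin d → ℝ) j :=
    fun j => ((Pi.basisFun ℝ (Fin d)).mem_span_iff_repr_mem ℤ _).1 (y - x).2 j
  choose z hz using hcoord
  have hzf : (fun j => (z j : ℝ)) = (y : Fin d → ℝ) - x := by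
    ext j
    simp [hz]
  refine ⟨f s, hs, f s', hs', z, ?_, ?_⟩
  · rintro rfl
    refine hxy (Subtype.ext ?_)
    have : (0 : Fin d → ℝ) = (y : Fin d → ℝ) - x := by
      rw [← hzf]; ext; simp
    exact (sub_eq_zero.1 this.symm).symm
  · rw [hzf, ← map_sub]
    have hw' : (y : Fin d → ℝ) + s' = (x : Fin d → ℝ) + s := hw
    have : s - s' = (y : Fin d → ℝ) - x := by
      rw [sub_eq_sub_iff_add_eq_add, add_comm s, ← hw']
    rw [this]
    rfl

theorem exists_abs_mulVec_lt_one (A : Matrix (Fin d) (Fin d) ℝ) (hA : A.det ≠ 0)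
    (hA1 : |A.det| < 1) :
    ∃ z : Fin d → ℤ, z ≠ 0 ∧ ∀ i, |(A *ᵥ fun j => (z j : ℝ)) i| < 1 := by
  obtain ⟨s, hs, s', hs', z, hz, h⟩ := exists_sub_eq_mulVec_intCast A hA
    (S := Set.univ.pi fun _ => Set.Ico 0 1)
    (MeasurableSet.univ_pi fun _ => measurableSet_Ico) (by
      rw [Real.volume_pi_Ico]
      simpa using hA1)
  refine ⟨z, hz, fun i => ?_⟩
  have h1 := hs i trivial
  have h2 := hs' i trivial
  rw [← h, Pi.sub_apply, abs_lt]
  constructor <;> linarith [h1.1, h1.2, h2.1, h2.2]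

theorem eq_of_mulVec_mem_cube {A : Matrix (Fin d) (Fin d) ℝ}
    (hpack : ∀ x : Fin d → ℤ, x ≠ 0 → ∃ i, 1 ≤ |(A *ᵥ fun j => (x j : ℝ)) i|)
    {y : Fin d → ℝ} {x x' : Fin d → ℤ}
    (hx : ∀ i, y i - (A *ᵥ fun j => (x j : ℝ)) i ∈ Set.Ico (0 : ℝ) 1)
    (hx' : ∀ i, y i - (A *ᵥ fun j => (x' j : ℝ)) i ∈ Set.Ico (0 : ℝ) 1) : x = x' := by
  by_contra hne
  obtain ⟨i, hi⟩ := hpack (x - x') (sub_ne_zero.2 hne)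
  have : (fun j => (((x - x') j : ℤ) : ℝ)) = (fun j => (x j : ℝ)) - fun j => (x' j : ℝ) := by
    ext; simp
  rw [this, Matrix.mulVec_sub, Pi.sub_apply] at hi
  refine absurd hi (not_le.2 (abs_lt.2 ?_))
  have h1 := hx i
  have h2 := hx' i
  constructor <;> linarith [h1.1, h1.2, h2.1, h2.2]

theorem finite_setOf_abs_mulVec_sub_le {A : Matrix (Fin d) (Fin d) ℝ} (hA : IsUnit A.det)
    (y : Fin d → ℝ) (r : ℝ) :
    {x : Fin d → ℤ | ∀ i, |y i - (A *ᵥ fun j => (x j : ℝ)) i| ≤ r}.Finite := by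
  let b : Fin d → ℝ := fun j => ∑ i, |A⁻¹ j i| * (|y i| + r)
  refine (Set.finite_Icc (fun j => ⌊-b j⌋) (fun j => ⌈b j⌉)).subset fun x hx => ?_
  have key : ∀ j, |(x j : ℝ)| ≤ b j := by
    intro j
    have : (x j : ℝ) = (A⁻¹ *ᵥ (A *ᵥ fun j => (x j : ℝ))) j := by
      rw [Matrix.mulVec_mulVec, Matrix.nonsing_inv_mul _ hA, Matrix.one_mulVec]
    rw [this, Matrix.mulVec, dotProduct]
    refine (Finset.abs_sum_le_sum_abs _ _).trans (Finset.sum_le_sum fun i _ => ?_)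
    rw [abs_mul]
    refine mul_le_mul_of_nonneg_left ?_ (abs_nonneg _)
    have h1 := hx i
    rw [abs_sub_comm] at h1
    have h2 := abs_sub_abs_le_abs_sub ((A *ᵥ fun j => (x j : ℝ)) i) (y i)
    linarith
  refine ⟨fun j => ?_, fun j => ?_⟩
  · exact_mod_cast (Int.floor_le (-b j)).trans (abs_le.1 (key j)).1
  · exact_mod_cast (abs_le.1 (key j)).2.trans (Int.le_ceil (b j))

theorem exists_mulVec_mem_cube {A : Matrix (Fin d) (Fin d) ℝ} (hdet : A.det = 1)
    (hpack : ∀ x : Fin d → ℤ, x ≠ 0 → ∃ i, 1 ≤ |(A *ᵥ fun j => (x j : ℝ)) i|)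
    (y : Fin d → ℝ) :
    ∃ x : Fin d → ℤ, ∀ i, y i - (A *ᵥ fun j => (x j : ℝ)) i ∈ Set.Ico (0 : ℝ) 1 := by
  by_contra! hy
  have hev : ∀ᶠ ε in 𝓝[>] (0 : ℝ), 0 < ε ∧ ε < 1 ∧
      ∀ x ∈ {x : Fin d → ℤ | ∀ i, |y i - (A *ᵥ fun j => (x j : ℝ)) i| ≤ 1},
        ∃ i, y i - (A *ᵥ fun j => (x j : ℝ)) i < -ε ∨
          1 ≤ y i - (A *ᵥ fun j => (x j : ℝ)) i := by
    have hlt : ∀ a : ℝ, 0 < a → ∀ᶠ ε in 𝓝[>] (0 : ℝ), ε < a := fun a ha =>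
      (Iio_mem_nhds ha : Set.Iio a ∈ 𝓝 (0 : ℝ)) |> mem_nhdsWithin_of_mem_nhds
    refine (eventually_mem_nhdsWithin.mono fun ε h => h).and ((hlt 1 one_pos).and ?_)
    refine (eventually_all_finite (finite_setOf_abs_mulVec_sub_le (by simp [hdet]) y 1)).2
      fun x _ => ?_
    obtain ⟨i, hi⟩ := hy x
    rw [Set.mem_Ico, not_and_or, not_le, not_lt] at hi
    rcases hi with hi | hi
    · filter_upwards [hlt _ (neg_pos.2 hi)] with ε hε
      exact ⟨i, Or.inl (by linarith)⟩
    · exact Eventually.of_forall fun _ => ⟨i, Or.inr hi⟩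
  obtain ⟨ε, hε0, hε1, hε⟩ := hev.exists
  let C : Set (Fin d → ℝ) := Set.univ.pi fun _ => Set.Ico 0 1
  let D : Set (Fin d → ℝ) := Set.univ.pi fun i => Set.Ico (y i) (y i + ε)
  have hCD : ∀ c ∈ C, ∀ e ∈ D, ∀ x : Fin d → ℤ, e - c ≠ A *ᵥ fun j => (x j : ℝ) := by
    intro c hc e he x h
    have hb : ∀ i, -ε < y i - (A *ᵥ fun j => (x j : ℝ)) i ∧
        y i - (A *ᵥ fun j => (x j : ℝ)) i < 1 := by
      intro i
      have h1 := hc i trivial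
      have h2 := he i trivial
      rw [← h, Pi.sub_apply]
      constructor <;> linarith [h1.1, h1.2, h2.1, h2.2]
    obtain ⟨i, hi⟩ := hε x fun i => abs_le.2 ⟨by linarith [(hb i).1], (hb i).2.le⟩
    rcases hi with hi | hi <;> linarith [(hb i).1, (hb i).2]
  have hdisj : Disjoint C D := Set.disjoint_left.2 fun s hs hs' =>
    hCD s hs s hs' 0 (by ext; simp [Matrix.mulVec, dotProduct])
  have hDm : MeasurableSet D := MeasurableSet.univ_pi fun _ => measurableSet_Ico
  obtain ⟨s, hs, s', hs', z, hz, h⟩ := exists_sub_eq_mulVec_intCast A (S := C ∪ D)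
    (by simp [hdet]) ((MeasurableSet.univ_pi fun _ => measurableSet_Ico).union hDm) (by
      rw [measure_union hdisj hDm, Real.volume_pi_Ico, Real.volume_pi_Ico]
      simp only [hdet, abs_one, ENNReal.ofReal_one, sub_zero, Finset.prod_const_one,
        add_sub_cancel_left]
      refine ENNReal.lt_add_right ENNReal.one_ne_top ?_
      simp [hε0])
  have hneg : s' - s = A *ᵥ fun j => (((-z) j : ℤ) : ℝ) := by
    have : (fun j => (((-z) j : ℤ) : ℝ)) = -fun j => (z j : ℝ) := by ext; simp
    rw [this, Matrix.mulVec_neg, ← h, neg_sub]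
  obtain ⟨i, hi⟩ := hpack z hz
  rw [← h, Pi.sub_apply] at hi
  rcases hs with hs | hs <;> rcases hs' with hs' | hs'
  · have h1 := hs i trivial
    have h2 := hs' i trivial
    refine absurd hi (not_le.2 (abs_lt.2 ?_))
    constructor <;> linarith [h1.1, h1.2, h2.1, h2.2]
  · exact hCD s hs s' hs' _ hneg
  · exact hCD s' hs' s hs _ h
  · have h1 := hs i trivial
    have h2 := hs' i trivial
    refine absurd hi (not_le.2 (abs_lt.2 ?_))
    constructor <;> linarith [h1.1, h1.2, h2.1, h2.2]

theorem exists_int_eq_add_of_existsUnique {X : Type*} {P : X → Prop} {g : X → ℝ}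
    (h : ∀ r : ℝ, ∃! x, P x ∧ r - g x ∈ Set.Ico (0 : ℝ) 1) {x y : X} (hx : P x) (hy : P y) :
    ∃ n : ℤ, g y = g x + n := by
  have step : ∀ x, P x → ∃ x', P x' ∧ g x' = g x + 1 := by
    intro x hx
    obtain ⟨x', ⟨hx', h1⟩, -⟩ := h (g x + 1)
    refine ⟨x', hx', ?_⟩
    by_contra hne
    have h2 : g x' < g x + 1 := lt_of_le_of_ne (by linarith [h1.1]) hne
    have : x = x' := (h (g x')).unique
      ⟨hx, by linarith [h1.2], by linarith⟩ ⟨hx', by simp⟩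
    subst this
    simp at h1
  have steps : ∀ (n : ℕ) (x : X), P x → ∃ x', P x' ∧ g x' = g x + n := by
    intro n x hx
    induction n with
    | zero => exact ⟨x, hx, by simp⟩
    | succ n ih =>
      obtain ⟨x', hx', h'⟩ := ih
      obtain ⟨x'', hx'', h''⟩ := step x' hx'
      exact ⟨x'', hx'', by rw [h'', h']; push_cast; ring⟩
  wlog hle : g x ≤ g y generalizing x y
  · obtain ⟨n, hn⟩ := this hy hx (le_of_not_ge hle)
    exact ⟨-n, by rw [hn]; push_cast; ring⟩
  obtain ⟨x', hx', h'⟩ := steps ⌊g y - g x⌋₊ x hx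
  have h1 := Nat.floor_le (sub_nonneg.2 hle)
  have h2 := Nat.lt_floor_add_one (g y - g x)
  have : y = x' := (h (g y)).unique ⟨hy, by simp⟩
    ⟨hx', by linarith, by linarith⟩
  subst this
  exact ⟨_, by rw [h', Int.cast_natCast]⟩

theorem existsUnique_add_shift {X : Type*} {P : X → Prop} {g : X → ℝ}
    (h : ∀ r : ℝ, ∃! x, P x ∧ r - g x ∈ Set.Ico (0 : ℝ) 1) {s : ℝ → ℝ}
    (hs : ∀ (a : ℝ) (n : ℤ), s (a + n) = s a) (r : ℝ) :
    ∃! x, P x ∧ r - (g x + s (g x)) ∈ Set.Ico (0 : ℝ) 1 := by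
  obtain ⟨x₀, ⟨hx₀, -⟩, -⟩ := h 0
  refine (existsUnique_congr fun x => and_congr_right fun hx => ?_).1 (h (r - s (g x₀)))
  obtain ⟨n, hn⟩ := exists_int_eq_add_of_existsUnique h hx₀ hx
  have : s (g x) = s (g x₀) := by rw [hn, hs]
  rw [this, sub_sub, add_comm (g x)]

theorem existsUnique_add_shifts {X : Type*} {g : X → Fin d → ℝ}
    (h : ∀ y : Fin d → ℝ, ∃! x, ∀ i, y i - g x i ∈ Set.Ico (0 : ℝ) 1) {s : Fin d → ℝ → ℝ}
    (hs : ∀ i (a : ℝ) (n : ℤ), s i (a + n) = s i a) (t : Finset (Fin d)) (y : Fin d → ℝ) :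
    ∃! x, ∀ i, y i - (g x i + if i ∈ t then s i (g x i) else 0) ∈ Set.Ico (0 : ℝ) 1 := by
  induction t using Finset.induction_on generalizing y with
  | empty => simpa using h y
  | insert k t hk ih =>
    have hiff : ∀ (F : Fin d → ℝ), (∀ i, F i ∈ Set.Ico (0 : ℝ) 1) ↔
        (∀ i, i ≠ k → F i ∈ Set.Ico (0 : ℝ) 1) ∧ F k ∈ Set.Ico (0 : ℝ) 1 := fun F =>
      ⟨fun h => ⟨fun i _ => h i, h k⟩, fun h i => by
        by_cases hi : i = k
        · exact hi ▸ h.2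
        · exact h.1 i hi⟩
    refine (existsUnique_congr fun x => ?_).1 (existsUnique_add_shift
      (P := fun x => ∀ i, i ≠ k →
        y i - (g x i + if i ∈ t then s i (g x i) else 0) ∈ Set.Ico (0 : ℝ) 1)
      (g := fun x => g x k) (fun r => ?_) (hs k) (y k))
    · rw [hiff]
      refine and_congr (forall₂_congr fun i hi => ?_) ?_
      · simp [hi]
      · simp
    · refine (existsUnique_congr fun x => ?_).1 (ih (Function.update y k r))
      rw [hiff]
      refine and_congr (forall₂_congr fun i hi => ?_) ?_
      · simp [hi]
      · simp [hk]

/-- Every nonzero integer vector is mapped by `A` to a vector having a nonzero integer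
coordinate. -/
def HasIntegerCoordinates (A : Matrix (Fin d) (Fin d) ℝ) : Prop :=
  ∀ x : Fin d → ℤ, x ≠ 0 → ∃ i, ∃ n : ℤ, n ≠ 0 ∧ (A *ᵥ fun j => (x j : ℝ)) i = n

/-- **Keller's theorem** for lattice tilings by cubes. -/
theorem hasIntegerCoordinates_of_packing {A : Matrix (Fin d) (Fin d) ℝ} (hdet : A.det = 1)
    (hpack : ∀ x : Fin d → ℤ, x ≠ 0 → ∃ i, 1 ≤ |(A *ᵥ fun j => (x j : ℝ)) i|) :
    HasIntegerCoordinates A := by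
  classical
  intro x hx
  by_contra! hcon
  set v := A *ᵥ fun j => (x j : ℝ) with hv
  have htile : ∀ y : Fin d → ℝ, ∃! x : Fin d → ℤ,
      ∀ i, y i - (A *ᵥ fun j => (x j : ℝ)) i ∈ Set.Ico (0 : ℝ) 1 := fun y => by
    obtain ⟨x, hx⟩ := exists_mulVec_mem_cube hdet hpack y
    exact ⟨x, hx, fun x' hx' => eq_of_mulVec_mem_cube hpack hx' hx⟩
  have h := existsUnique_add_shifts htile
    (s := fun i a => if ∃ n : ℤ, a = v i + n then -v i else 0) (by
      intro i a n
      refine if_congr ⟨?_, ?_⟩ rfl rfl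
      · rintro ⟨m, hm⟩
        exact ⟨m - n, by push_cast; linarith⟩
      · rintro ⟨m, hm⟩
        exact ⟨m + n, by push_cast; linarith⟩) Finset.univ 0
  refine hx (h.unique (fun i => ?_) (fun i => ?_))
  · have : ∃ n : ℤ, v i = v i + n := ⟨0, by simp⟩
    rw [← hv]
    simp only [Finset.mem_univ, if_true, if_pos this]
    simp
  · have h0 : (A *ᵥ fun j => (((0 : Fin d → ℤ) j : ℤ) : ℝ)) i = 0 := by
      simp [Matrix.mulVec, dotProduct]
    rw [h0]
    simp only [Finset.mem_univ, if_true]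
    split_ifs with hn
    · obtain ⟨n, hn⟩ := hn
      have h1 : v i = ((-n : ℤ) : ℝ) := by push_cast; linarith
      have h2 : -n = 0 := by
        by_contra h3
        exact hcon i _ h3 h1
      rw [h1, h2]
      simp
    · simp

theorem HasIntegerCoordinates.updateRow {A : Matrix (Fin d) (Fin d) ℝ}
    (hA : HasIntegerCoordinates A) (i : Fin d) {f : ℝ →+ ℝ} (hf : f 1 = 1) :
    HasIntegerCoordinates (A.updateRow i fun j => f (A i j)) := by
  intro x hx
  obtain ⟨k, n, hn, hk⟩ := hA x hx
  have hmul : ∀ (a : ℝ) (m : ℤ), f (a * m) = f a * m := fun a m => by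
    rw [mul_comm, ← zsmul_eq_mul, map_zsmul, zsmul_eq_mul, mul_comm]
  refine ⟨k, n, hn, ?_⟩
  by_cases hki : k = i
  · subst hki
    have h1 : f n = n := by simpa [hf] using hmul 1 n
    rw [← h1, ← hk]
    simp [Matrix.mulVec, dotProduct, hmul]
  · rw [← hk]
    simp [Matrix.mulVec, dotProduct, hki]

theorem HasIntegerCoordinates.not_abs_det_lt_one {A : Matrix (Fin d) (Fin d) ℝ}
    (hA : HasIntegerCoordinates A) (h0 : A.det ≠ 0) : ¬ |A.det| < 1 := by
  intro h1
  obtain ⟨x, hx, hlt⟩ := exists_abs_mulVec_lt_one A h0 h1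
  obtain ⟨i, n, hn, hi⟩ := hA x hx
  have := hlt i
  rw [hi, ← Int.cast_abs] at this
  exact hn (Int.abs_lt_one_iff.1 (by exact_mod_cast this))

theorem HasIntegerCoordinates.det_updateRow {A : Matrix (Fin d) (Fin d) ℝ}
    (hA : HasIntegerCoordinates A) (hdet : A.det = 1) (i : Fin d) {f : ℝ →+ ℝ} (hf : f 1 = 1) :
    (A.updateRow i fun j => f (A i j)).det = 1 := by
  set c := (A.updateRow i fun j => f (A i j) - A i j).det with hc
  have key : ∀ s : ℝ, (A.updateRow i fun j => A i j + s * (f (A i j) - A i j)).det =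
      1 + s * c := by
    intro s
    have : (fun j => A i j + s * (f (A i j) - A i j)) =
        A i + s • fun j => f (A i j) - A i j := by
      ext j; simp
    rw [this, Matrix.det_updateRow_add, Matrix.det_updateRow_smul, Matrix.updateRow_eq_self, hdet]
  have hc0 : c = 0 := by
    by_contra hne
    have h := hA.updateRow i (f := AddMonoidHom.id ℝ +
      (AddMonoidHom.mulLeft (-1 / (2 * c))).comp (f - AddMonoidHom.id ℝ)) (by simp [hf])
    have hd : (A.updateRow i fun j => (AddMonoidHom.id ℝ +
        (AddMonoidHom.mulLeft (-1 / (2 * c))).comp (f - AddMonoidHom.id ℝ)) (A i j)).det =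
        1 / 2 := by
      refine (key (-1 / (2 * c))).trans ?_
      field_simp
      norm_num
    refine h.not_abs_det_lt_one ?_ ?_ <;> rw [hd]
    · norm_num
    · rw [abs_of_pos] <;> norm_num
  have := key 1
  simpa [hc0] using this

theorem exists_linearMap_rat_not_int {a : ℝ} (ha : ¬ ∃ z : ℤ, a = z) :
    ∃ f : ℝ →ₗ[ℚ] ℚ, f 1 = 1 ∧ ¬ ∃ z : ℤ, f a = z := by
  obtain ⟨f, -, hf⟩ := LinearMap.exists_extend_of_notMem (p := (⊥ : Submodule ℚ ℝ))
    (0 : _ →ₗ[ℚ] ℚ) (v := (1 : ℝ)) (by simp) 1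
  by_cases h : a ∈ Submodule.span ℚ {(1 : ℝ)}
  · obtain ⟨q, rfl⟩ := Submodule.mem_span_singleton.1 h
    refine ⟨f, hf, ?_⟩
    rintro ⟨z, hz⟩
    refine ha ⟨z, ?_⟩
    rw [map_smul, hf, smul_eq_mul, mul_one] at hz
    simp [hz, Rat.smul_def]
  · obtain ⟨g, hg, hga⟩ := LinearMap.exists_extend_of_notMem
      (f.comp (Submodule.span ℚ {(1 : ℝ)}).subtype) h (1 / 2)
    refine ⟨g, ?_, ?_⟩
    · have := LinearMap.congr_fun hg ⟨1, Submodule.mem_span_singleton_self 1⟩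
      simpa [hf] using this
    · rintro ⟨z, hz⟩
      rw [hga] at hz
      have h2 : (1 : ℚ) = 2 * z := by linarith
      have : (1 : ℤ) = 2 * z := by exact_mod_cast h2
      omega

theorem HasIntegerCoordinates.map_rows {A : Matrix (Fin d) (Fin d) ℝ}
    (hA : HasIntegerCoordinates A) (hdet : A.det = 1) {f : Fin d → ℝ →+ ℝ}
    (hf : ∀ i, f i 1 = 1) (t : Finset (Fin d)) :
    HasIntegerCoordinates (Matrix.of fun i j => if i ∈ t then f i (A i j) else A i j) ∧
      (Matrix.of fun i j => if i ∈ t then f i (A i j) else A i j).det = 1 := by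
  induction t using Finset.induction_on with
  | empty => simpa using! And.intro hA hdet
  | insert k t hk ih =>
    obtain ⟨h1, h2⟩ := ih
    have : (Matrix.of fun i j => if i ∈ insert k t then f i (A i j) else A i j) =
        (Matrix.of fun i j => if i ∈ t then f i (A i j) else A i j).updateRow k fun j =>
          f k ((Matrix.of fun i j => if i ∈ t then f i (A i j) else A i j) k j) := by
      ext i j
      by_cases hi : i = k
      · subst hi; simp [hk]
      · simp [hi]
    rw [this]
    exact ⟨h1.updateRow k (hf k), h1.det_updateRow h2 k (hf k)⟩

end CubeTiling

/-- Minkowski's conjecture (Hajós' theorem), first form: if `det A = 1` and no row of `A`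
is an integer vector, then some nonzero integer vector `x` satisfies `‖Ax‖_∞ < 1`. -/
theorem minkowski_hajos_first_form {d : ℕ} (hd : 0 < d)
    (A : Matrix (Fin d) (Fin d) ℝ) (hdet : A.det = 1)
    (hrow : ∀ i : Fin d, ∃ j : Fin d, ¬ ∃ z : ℤ, A i j = (z : ℝ)) :
    ∃ x : Fin d → ℤ, x ≠ 0 ∧ ∀ i : Fin d, |A.mulVec (fun j => (x j : ℝ)) i| < 1 := by
  by_contra! hpack
  choose k hk using hrow
  choose f hf1 hfk using fun i => exists_linearMap_rat_not_int (hk i)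
  let B : Matrix (Fin d) (Fin d) ℚ := Matrix.of fun i j => f i (A i j)
  obtain ⟨hB, hBdet⟩ := (hasIntegerCoordinates_of_packing hdet hpack).map_rows hdet
    (f := fun i => (Rat.castHom ℝ : ℚ →+ ℝ).comp (f i).toAddMonoidHom)
    (fun i => by simp [hf1]) Finset.univ
  have hM : B.map (Rat.cast : ℚ → ℝ) = Matrix.of fun i j => if i ∈ Finset.univ then
      ((Rat.castHom ℝ : ℚ →+ ℝ).comp (f i).toAddMonoidHom) (A i j) else A i j := by
    ext i j
    simp [B]
  rw [← hM] at hB hBdet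
  have hBdet' : B.det = 1 := by
    have : ((B.det : ℚ) : ℝ) = 1 := (RingHom.map_det (Rat.castHom ℝ) B).trans hBdet
    exact_mod_cast this
  obtain ⟨i, hi⟩ := exists_integer_row_of_rational hd B hBdet' hB
  exact hfk i (hi (k i))
end

section
/- Let f, g : ℝ^d → ℝ be measurable with f, g ≥ 0 and ∫ f = ∫ g = 1, and let T ⊆ ℝ^d be a countable set such that both f + T and g + T are packings of ℝ^d. Then f + T is a tiling of ℝ^d if and only if g + T is a tiling of ℝ^d. -/
open MeasureTheory
open scoped ENNReal

/-- `f + T` is a packing of `ℝ^d`: `∑_{t ∈ T} f(x − t) ≤ 1` for a.e. `x`. -/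
def IsPackingF {d : ℕ} (f : (Fin d → ℝ) → ℝ) (T : Set (Fin d → ℝ)) : Prop :=
  ∀ᵐ x ∂(volume : Measure (Fin d → ℝ)),
    ∑' t : T, ENNReal.ofReal (f (x - ↑t)) ≤ 1

/-- `f + T` is a tiling of `ℝ^d`: `∑_{t ∈ T} f(x − t) = 1` for a.e. `x`. -/
def IsTilingF {d : ℕ} (f : (Fin d → ℝ) → ℝ) (T : Set (Fin d → ℝ)) : Prop :=
  ∀ᵐ x ∂(volume : Measure (Fin d → ℝ)),
    ∑' t : T, ENNReal.ofReal (f (x - ↑t)) = 1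

/-- In a commutative group, if the translates of `F` by `T` sum to `1` almost everywhere, those of
`G` sum to at most `1`, and `F`, `G` both have total mass `1`, then the translates of `G` sum to `1`
almost everywhere. -/
theorem ae_tsum_translate_eq_one_of_le_one {E : Type*} [AddCommGroup E] [MeasurableSpace E]
    [MeasurableAdd₂ E] [MeasurableNeg E] (μ : Measure E) [SFinite μ] [μ.IsAddLeftInvariant]
    [μ.IsNegInvariant] {F G : E → ℝ≥0∞} (hF : Measurable F) (hG : Measurable G)
    (hF1 : ∫⁻ x, F x ∂μ = 1) (hG1 : ∫⁻ x, G x ∂μ = 1) {T : Set E} (hT : T.Countable)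
    (hFT : ∀ᵐ x ∂μ, ∑' t : T, F (x - t) = 1) (hGT : ∀ᵐ x ∂μ, ∑' t : T, G (x - t) ≤ 1) :
    ∀ᵐ x ∂μ, ∑' t : T, G (x - t) = 1 := by
  have : Countable T := hT.to_subtype
  set S : E → ℝ≥0∞ := fun y => ∑' t : T, G (y - t) with hS
  have hSm : Measurable S := Measurable.tsum fun t => hG.comp (measurable_id.sub_const _)
  have hFx (x : E) : Measurable fun y => F (x - y) := hF.comp (measurable_id.const_sub x)
  -- Convolving `F` with the translates of `G` gives `1`, by moving the translations onto `F`.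
  have hconv (x : E) : ∫⁻ y, F (x - y) * S y ∂μ = 1 := by
    calc ∫⁻ y, F (x - y) * S y ∂μ = ∑' t : T, ∫⁻ y, F (x - y) * G (y - t) ∂μ := by
          simp only [hS, ← ENNReal.tsum_mul_left]
          exact lintegral_tsum fun t =>
            ((hFx x).mul (hG.comp (measurable_id.sub_const _))).aemeasurable
      _ = ∑' t : T, ∫⁻ z, F (x - z - t) * G z ∂μ := by
          refine tsum_congr fun t => ?_
          rw [← lintegral_add_right_eq_self _ (t : E)]
          simp only [add_sub_cancel_right, sub_sub]
      _ = ∫⁻ z, (∑' t : T, F (x - z - t)) * G z ∂μ := by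
          simp only [← ENNReal.tsum_mul_right]
          refine (lintegral_tsum fun t => Measurable.aemeasurable ?_).symm
          exact (hF.comp ((measurable_id.const_sub x).sub_const _)).mul hG
      _ = ∫⁻ z, G z ∂μ := by
          refine lintegral_congr_ae ?_
          filter_upwards [(quasiMeasurePreserving_sub_left μ x).ae hFT] with z hz
          rw [hz, one_mul]
      _ = 1 := hG1
  have hdefect (x : E) : ∫⁻ y, F (x - y) * (1 - S y) ∂μ = 0 := by
    have hsum : ∫⁻ y, F (x - y) * S y ∂μ + ∫⁻ y, F (x - y) * (1 - S y) ∂μ = 1 := by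
      rw [← lintegral_add_left (by fun_prop)]
      refine (lintegral_congr_ae ?_).trans ((lintegral_sub_left_eq_self F x).trans hF1)
      filter_upwards [hGT] with y (hy : S y ≤ 1)
      rw [← mul_add, add_tsub_cancel_of_le hy, mul_one]
    rw [hconv] at hsum
    exact (ENNReal.add_right_inj ENNReal.one_ne_top).1 (hsum.trans (add_zero 1).symm)
  have hDm : Measurable fun y => 1 - S y := measurable_const.sub hSm
  have hD : ∫⁻ y, (1 - S y) ∂μ = 0 := by
    calc ∫⁻ y, (1 - S y) ∂μ = ∫⁻ y, ∫⁻ x, F (x - y) * (1 - S y) ∂μ ∂μ := by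
          refine lintegral_congr fun y => ?_
          rw [lintegral_mul_const _ (by fun_prop),
            lintegral_sub_right_eq_self F y, hF1, one_mul]
      _ = ∫⁻ x, ∫⁻ y, F (x - y) * (1 - S y) ∂μ ∂μ :=
          lintegral_lintegral_swap
            ((hF.comp (measurable_snd.sub measurable_fst)).mul
              (hDm.comp measurable_fst)).aemeasurable
      _ = 0 := by simp only [hdefect, lintegral_zero]
  filter_upwards [(lintegral_eq_zero_iff hDm).1 hD, hGT] with y hy hle
  exact le_antisymm hle (tsub_eq_zero_iff_le.1 hy)

/-- A nonnegative function with Bochner integral `1` has lower Lebesgue integral `1`. -/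
theorem lintegral_ofReal_eq_one_of_integral_eq_one {α : Type*} [MeasurableSpace α] {μ : Measure α}
    {f : α → ℝ} (hf0 : ∀ x, 0 ≤ f x) (hf1 : ∫ x, f x ∂μ = 1) :
    ∫⁻ x, ENNReal.ofReal (f x) ∂μ = 1 := by
  have hf : Integrable f μ := Integrable.of_integral_ne_zero (hf1 ▸ one_ne_zero)
  rw [← ofReal_integral_eq_lintegral_ofReal hf (.of_forall hf0), hf1, ENNReal.ofReal_one]

/-- If `f, g ≥ 0` have integral `1` and both `f + T` and `g + T` are packings,
then `f + T` is a tiling iff `g + T` is a tiling. -/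
theorem tiling_from_packing {d : ℕ} (f g : (Fin d → ℝ) → ℝ)
    (hfm : Measurable f) (hgm : Measurable g)
    (hf0 : ∀ x, 0 ≤ f x) (hg0 : ∀ x, 0 ≤ g x)
    (hfi : ∫ x : Fin d → ℝ, f x = 1) (hgi : ∫ x : Fin d → ℝ, g x = 1)
    (T : Set (Fin d → ℝ)) (hT : T.Countable)
    (hfp : IsPackingF f T) (hgp : IsPackingF g T) :
    IsTilingF f T ↔ IsTilingF g T := by
  have hf1 := lintegral_ofReal_eq_one_of_integral_eq_one hf0 hfi
  have hg1 := lintegral_ofReal_eq_one_of_integral_eq_one hg0 hgi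
  exact ⟨fun h => ae_tsum_translate_eq_one_of_le_one volume hfm.ennreal_ofReal
      hgm.ennreal_ofReal hf1 hg1 hT h hgp,
    fun h => ae_tsum_translate_eq_one_of_le_one volume hgm.ennreal_ofReal
      hfm.ennreal_ofReal hg1 hf1 hT h hfp⟩
end

section
/- Let Σ be a nonempty finite set and let X ⊆ Σ^ℤ be a closed subset (in the product topology) invariant under the shift map. Suppose X is determined by left half-lines (whenever x, y ∈ X satisfy x_n = y_n for all n ≤ a, for some a ∈ ℤ, then x = y) and determined by right half-lines (whenever x, y ∈ X satisfy x_n = y_n for all n ≥ a, for some a ∈ ℤ, then x = y). Then there exists a finite w ∈ ℕ such that X is determined by windows of size w: whenever x, y ∈ X satisfy x_n = y_n for all n with a ≤ n < a + w, for some a ∈ ℤ, then x = y. -/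
theorem translate_mem_of_shift_invariant {σ : Type*} {X : Set (ℤ → σ)}
    (hshift : ∀ x : ℤ → σ, x ∈ X ↔ (fun n => x (n + 1)) ∈ X)
    {x : ℤ → σ} (hx : x ∈ X) (m : ℤ) : (fun n => x (n + m)) ∈ X := by
  induction m using Int.induction_on with
  | zero => simpa using hx
  | succ i ih =>
    have h := (hshift _).1 ih
    convert h using 3
    ring
  | pred i ih =>
    refine (hshift _).2 ?_
    convert ih using 3
    ring

/-- By compactness, in a closed set determined by left half-lines the coordinate at `1` is
determined by finitely many coordinates to its left. -/
theorem exists_window_determines_next {σ : Type*} [Finite σ]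
    [TopologicalSpace σ] [DiscreteTopology σ] {X : Set (ℤ → σ)} (hclosed : IsClosed X)
    (hleft : ∀ x ∈ X, ∀ y ∈ X, ∀ a : ℤ, (∀ n : ℤ, n ≤ a → x n = y n) → x = y) :
    ∃ k : ℕ, ∀ x ∈ X, ∀ y ∈ X, (∀ n : ℤ, -k ≤ n → n ≤ 0 → x n = y n) → x 1 = y 1 := by
  by_contra! hne
  let C : ℕ → Set ((ℤ → σ) × (ℤ → σ)) := fun k =>
    (X ×ˢ X) ∩ ({p | ∀ n : ℤ, -k ≤ n → n ≤ 0 → p.1 n = p.2 n} ∩ {p | p.1 1 ≠ p.2 1})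
  have hC : ∀ k, IsClosed (C k) := by
    intro k
    refine (hclosed.prod hclosed).inter (IsClosed.inter ?_ ?_)
    · simp only [Set.ofPred_forall]
      refine isClosed_iInter fun n => isClosed_iInter fun _ => isClosed_iInter fun _ => ?_
      exact isClosed_eq (by fun_prop) (by fun_prop)
    · have hcont : Continuous fun p : (ℤ → σ) × (ℤ → σ) => (p.1 1, p.2 1) := by fun_prop
      exact (isClosed_discrete {q : σ × σ | q.1 ≠ q.2}).preimage hcont
  obtain ⟨⟨x, y⟩, hxy⟩ := IsCompact.nonempty_iInter_of_sequence_nonempty_isCompact_isClosed C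
    (fun k p hp => ⟨hp.1, fun n h₁ h₂ => hp.2.1 n (by push_cast; lia) h₂, hp.2.2⟩)
    (fun k => by
      obtain ⟨x, hx, y, hy, h, h₁⟩ := hne k
      exact ⟨(x, y), ⟨hx, hy⟩, h, h₁⟩)
    (hC 0).isCompact hC
  rw [Set.mem_iInter] at hxy
  have heq : x = y := hleft x (hxy 0).1.1 y (hxy 0).1.2 0 fun n hn =>
    (hxy n.natAbs).2.1 n (by lia) hn
  exact (hxy 0).2.2 (congrFun heq 1)


/-- A closed shift-invariant subset of `Σ^ℤ` (`Σ` a nonempty finite discrete alphabet)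
which is determined by left half-lines and by right half-lines is determined by windows
of some finite size `w`. -/
theorem determined_by_windows {σ : Type*} [Fintype σ] [Nonempty σ]
    [TopologicalSpace σ] [DiscreteTopology σ]
    (X : Set (ℤ → σ)) (hclosed : IsClosed X)
    (hshift : ∀ x : ℤ → σ, x ∈ X ↔ (fun n => x (n + 1)) ∈ X)
    (hleft : ∀ x ∈ X, ∀ y ∈ X, ∀ a : ℤ, (∀ n : ℤ, n ≤ a → x n = y n) → x = y)
    (hright : ∀ x ∈ X, ∀ y ∈ X, ∀ a : ℤ, (∀ n : ℤ, a ≤ n → x n = y n) → x = y) :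
    ∃ w : ℕ, ∀ x ∈ X, ∀ y ∈ X, ∀ a : ℤ,
      (∀ n : ℤ, a ≤ n → n < a + w → x n = y n) → x = y := by
  obtain ⟨k, hk⟩ := exists_window_determines_next hclosed hleft
  refine ⟨k + 1, fun x hx y hy a hwin => hright x hx y hy a ?_⟩
  have key : ∀ j : ℕ, ∀ n : ℤ, a ≤ n → n < a + (k + 1 : ℕ) + j → x n = y n := by
    intro j
    induction j with
    | zero => simpa using hwin
    | succ j ih =>
      intro n hn hlt
      by_cases h : n < a + (k + 1 : ℕ) + j
      · exact ih n hn h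
      · have h₁ := hk _ (translate_mem_of_shift_invariant hshift hx (n - 1))
          _ (translate_mem_of_shift_invariant hshift hy (n - 1))
          (fun i hi hi₀ => ih _ (by push_cast at h hlt; lia) (by push_cast at h hlt ⊢; lia))
        simpa using h₁
  intro n hn
  exact key (n - a).natAbs n hn (by lia)
end

section
/- Let G = (ℤ/2ℤ)^12 and let E = {e₁, …, e₁₂} ⊆ G be the set of the 12 standard basis vectors (e_j has a 1 in position j and 0 elsewhere). Then E is spectral in G but E does not tile G by translations. Hence the 'spectral implies tiling' direction of the Fuglede conjecture fails in (ℤ/2ℤ)^12. -/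
/-- The group `G = (ℤ/2ℤ)^12`. -/
abbrev G15 : Type := Fin 12 → ZMod 2

/-- The character `e_γ(x) = (−1)^{∑ⱼ γⱼ xⱼ}` of `(ℤ/2ℤ)^12`. -/
noncomputable def chr15 (γ x : G15) : ℂ := (-1 : ℂ) ^ (∑ j, (γ j * x j).val)

/-- The set `E = {e₁, …, e₁₂}` of the standard basis vectors of `(ℤ/2ℤ)^12`. -/
def stdBasis15 : Finset G15 :=
  Finset.image (fun j : Fin 12 => (fun i => if i = j then 1 else 0 : G15)) Finset.univ

/-- The exponents of the signs of the Paley Hadamard matrix of order `12`, built from the nonzero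
quadratic residues modulo `11`. -/
def paleyExponent (i j : Fin 12) : ZMod 2 :=
  if j = 11 then 0 else if i = 11 then 1 else
    if (j.val + 11 - i.val) % 11 ∈ [1, 3, 4, 5, 9] then 1 else 0

lemma paleyExponent_orthogonal : ∀ i i' : Fin 12, i ≠ i' →
    ∑ j, (-1 : ℤ) ^ (paleyExponent i j).val * (-1) ^ (paleyExponent i' j).val = 0 := by
  decide +kernel

lemma paleyExponent_injective : Function.Injective paleyExponent := by
  decide +kernel

lemma stdBasis15_injective :
    Function.Injective (fun j : Fin 12 => (fun i => if i = j then 1 else 0 : G15)) := by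
  intro a b h
  by_contra hab
  simpa [hab] using congrFun h a

lemma stdBasis15_card : stdBasis15.card = 12 := by
  simp [stdBasis15, Finset.card_image_of_injective _ stdBasis15_injective]

lemma chr15_basis (γ : G15) (j : Fin 12) :
    chr15 γ (fun i => if i = j then 1 else 0) = (-1) ^ (γ j).val := by
  simp [chr15, apply_ite ZMod.val]

/-- A finite set tiling a finite group has cardinality dividing the order of the group. -/
lemma card_dvd_of_tiles {G : Type*} [AddGroup G] [Finite G] {E : Finset G} {T : Set G}
    (h : ∀ g : G, ∃! et : G × G, et.1 ∈ E ∧ et.2 ∈ T ∧ et.1 + et.2 = g) :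
    E.card ∣ Nat.card G := by
  have hb : Function.Bijective (fun p : E × T => (p.1 : G) + p.2) := by
    refine ⟨fun p q hpq => ?_, fun g => ?_⟩
    · have := (h (p.1 + p.2)).unique (y₁ := (↑p.1, ↑p.2)) (y₂ := (↑q.1, ↑q.2))
        ⟨p.1.2, p.2.2, rfl⟩ ⟨q.1.2, q.2.2, hpq.symm⟩
      rw [Prod.mk.injEq] at this
      exact Prod.ext (Subtype.ext this.1) (Subtype.ext this.2)
    · obtain ⟨⟨e, t⟩, ⟨he, ht, hg⟩, -⟩ := h g
      exact ⟨(⟨e, he⟩, ⟨t, ht⟩), hg⟩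
  refine ⟨Nat.card T, ?_⟩
  rw [← Nat.card_congr (Equiv.ofBijective _ hb), Nat.card_prod]
  simp

/-- In `G = (ℤ/2ℤ)^12` the set of the 12 standard basis vectors is spectral (it admits a
set `Γ` of 12 characters pairwise orthogonal on it) but does not tile `G` by translations:
the "spectral ⟹ tiling" direction of the Fuglede conjecture fails in `(ℤ/2ℤ)^12`. -/
theorem spectral_not_tile_in_Z2_pow_12 :
    (∃ Γ : Finset G15, Γ.card = stdBasis15.card ∧
      ∀ γ ∈ Γ, ∀ γ' ∈ Γ, γ ≠ γ' →
        ∑ x ∈ stdBasis15, chr15 γ x * (starRingEnd ℂ) (chr15 γ' x) = 0) ∧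
    ¬ ∃ T : Set G15, ∀ g : G15, ∃! et : G15 × G15,
        et.1 ∈ stdBasis15 ∧ et.2 ∈ T ∧ et.1 + et.2 = g := by
  refine ⟨⟨Finset.univ.image paleyExponent, ?_, ?_⟩, ?_⟩
  · simp [Finset.card_image_of_injective _ paleyExponent_injective, stdBasis15_card]
  · simp only [Finset.mem_image, Finset.mem_univ, true_and]
    rintro _ ⟨i, rfl⟩ _ ⟨i', rfl⟩ hne
    have h := paleyExponent_orthogonal i i' (fun h => hne (congrArg _ h))
    rw [stdBasis15, Finset.sum_image stdBasis15_injective.injOn]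
    simp only [chr15_basis, map_pow, map_neg, map_one]
    exact_mod_cast h
  · rintro ⟨T, hT⟩
    have h := card_dvd_of_tiles hT
    rw [stdBasis15_card] at h
    norm_num at h
end

section
/- Let G be a finite abelian group and let E ⊆ G be a nonempty spectral set (with respect to counting measure). Then E admits a weak tiling of G: there exists a function w : G → ℝ with w ≥ 0, w(0) = 1, and ∑_{y ∈ G} 1_E(x − y) · w(y) = 1 for every x ∈ G. -/
open scoped BigOperators

/-- In a finite abelian group, a nonempty spectral set admits a weak tiling: a nonnegative
weight function `w` with `w 0 = 1` such that `∑_y 1_E(x − y) w(y) = 1` for every `x`. -/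
theorem spectral_implies_weak_tiling {G : Type*} [AddCommGroup G] [Fintype G]
    [DecidableEq G] (E : Finset G) (hne : E.Nonempty)
    (hspec : ∃ Λ : Finset (AddChar G ℂ), Λ.card = E.card ∧
      (∀ χ ∈ Λ, ∀ x : G, ‖χ x‖ = 1) ∧
      (∀ χ ∈ Λ, ∀ ψ ∈ Λ, χ ≠ ψ → ∑ x ∈ E, χ x * (starRingEnd ℂ) (ψ x) = 0)) :
    ∃ w : G → ℝ, (∀ y : G, 0 ≤ w y) ∧ w 0 = 1 ∧
      ∀ x : G, ∑ y : G, (if x - y ∈ E then w y else 0) = 1 := by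
  obtain ⟨Λ, hcard, hnorm, horth⟩ := hspec
  have hN : (E.card : ℝ) ≠ 0 := by exact_mod_cast hne.card_ne_zero
  refine ⟨fun y => ‖∑ χ ∈ Λ, χ y‖ ^ 2 / (E.card : ℝ) ^ 2, fun y => by positivity, ?_, fun x => ?_⟩
  · simp [hcard, hN]
  have hsum : ∑ e ∈ E, ‖∑ χ ∈ Λ, χ (x - e)‖ ^ 2 = (E.card : ℝ) ^ 2 := by
    have hdiag (χ : AddChar G ℂ) (hχ : χ ∈ Λ) (y : G) : χ y * (starRingEnd ℂ) (χ y) = 1 := by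
      simp [Complex.mul_conj', hnorm χ hχ y]
    have hinner (χ : AddChar G ℂ) (hχ : χ ∈ Λ) (ψ : AddChar G ℂ) (hψ : ψ ∈ Λ) :
        ∑ e ∈ E, χ (x - e) * (starRingEnd ℂ) (ψ (x - e)) = if χ = ψ then (E.card : ℂ) else 0 := by
      split_ifs with h
      · subst h
        simp [hdiag χ hχ]
      · calc
          _ = χ x * (starRingEnd ℂ) (ψ x) * ∑ e ∈ E, ψ e * (starRingEnd ℂ) (χ e) := by
            rw [Finset.mul_sum]
            refine Finset.sum_congr rfl fun e _ => ?_
            simp only [sub_eq_add_neg, AddChar.map_add_eq_mul, AddChar.map_neg_eq_conj, map_mul,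
              Complex.conj_conj]
            ring
          _ = 0 := by rw [horth ψ hψ χ hχ (Ne.symm h), mul_zero]
    have hcomplex : ∑ e ∈ E, ((‖∑ χ ∈ Λ, χ (x - e)‖ : ℂ)) ^ 2 = (E.card : ℂ) ^ 2 := by
      simp_rw [← Complex.mul_conj', map_sum, Finset.sum_mul_sum]
      rw [Finset.sum_comm]
      calc
        _ = ∑ χ ∈ Λ, ∑ ψ ∈ Λ, if χ = ψ then (E.card : ℂ) else 0 := by
          refine Finset.sum_congr rfl fun χ hχ => ?_
          rw [Finset.sum_comm]
          exact Finset.sum_congr rfl fun ψ hψ => hinner χ hχ ψ hψ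
        _ = (E.card : ℂ) ^ 2 := by
          simp [hcard, sq]
    exact_mod_cast hcomplex
  calc
    _ = ∑ e : G, if e ∈ E then ‖∑ χ ∈ Λ, χ (x - e)‖ ^ 2 / (E.card : ℝ) ^ 2 else 0 :=
      Fintype.sum_equiv (Equiv.subLeft x) _ _ fun y => by simp
    _ = 1 := by
      rw [Finset.sum_ite_mem, Finset.univ_inter, ← Finset.sum_div, hsum,
        div_self (pow_ne_zero 2 hN)]
end

section
/- Let D be the closed unit disk in ℝ² centered at the origin. There exist absolute constants C₁, C₂ > 0 such that for every set Λ ⊆ ℝ² with at least two elements which is orthogonal for D (i.e. 1̂_D(λ − μ) = 0 for all distinct λ, μ ∈ Λ), setting t = inf{|λ − μ| : λ, μ ∈ Λ, λ ≠ μ}, one has |Λ| ≤ C₁ · t (in particular Λ is finite), and moreover |Λ ∩ [−R, R]²| ≤ C₂ · R^{2/3} for all R ≥ 1. -/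
open MeasureTheory Complex

/-- The closed unit disk in the plane. -/
def unitDisk : Set (Fin 2 → ℝ) := {x | (x 0) ^ 2 + (x 1) ^ 2 ≤ 1}

/-- The Fourier transform of the indicator function of the unit disk. -/
noncomputable def ftDisk (ξ : Fin 2 → ℝ) : ℂ :=
  ∫ x in unitDisk,
    Complex.exp (-(2 * Real.pi * Complex.I * ((ξ 0 * x 0 + ξ 1 * x 1 : ℝ) : ℂ)))

/-- The Euclidean norm on the plane. -/
noncomputable def euc2 (v : Fin 2 → ℝ) : ℝ := Real.sqrt ((v 0) ^ 2 + (v 1) ^ 2)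

/-- The integral `∫_{-1}^1 √(1 - s²) e^{ixs} ds`, which equals `π J₁(x) / x`. -/
noncomputable def besselIntegral (x : ℝ) : ℂ :=
  ∫ s in (-1 : ℝ)..1, ((√(1 - s ^ 2) : ℝ) : ℂ) * Complex.exp (x * s * Complex.I)

lemma euc2_sq (v : Fin 2 → ℝ) : euc2 v ^ 2 = v 0 ^ 2 + v 1 ^ 2 :=
  Real.sq_sqrt (by positivity)

/-- Rotating the disk so that the frequency points along the first axis. -/
lemma ftDisk_eq_rotate {ξ : Fin 2 → ℝ} (hξ : 0 < euc2 ξ) :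
    ftDisk ξ = ∫ x in unitDisk, Complex.exp (((2 * Real.pi * euc2 ξ : ℝ) : ℂ) * (x 0 : ℝ) * I) := by
  set r := euc2 ξ with hr
  have hr2 : r ^ 2 = ξ 0 ^ 2 + ξ 1 ^ 2 := euc2_sq ξ
  have hrn : r ≠ 0 := hξ.ne'
  set M : Matrix (Fin 2) (Fin 2) ℝ := !![-ξ 0 / r, ξ 1 / r; -ξ 1 / r, -ξ 0 / r] with hM
  have hdet : M.det = 1 := by
    rw [hM, Matrix.det_fin_two_of]
    field_simp
    linarith
  have hmap : MeasurePreserving (Matrix.toLin' M) (volume : Measure (Fin 2 → ℝ)) volume := by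
    refine ⟨(LinearMap.continuous_of_finiteDimensional _).measurable, ?_⟩
    rw [Real.map_matrix_volume_pi_eq_smul_volume_pi (by rw [hdet]; norm_num), hdet]
    simp
  have hinj : Function.Injective (Matrix.toLin' M) := by
    intro x y h
    exact Matrix.mulVec_injective_of_det_ne_zero (M := M) (by rw [hdet]; norm_num)
      (by simpa only [Matrix.toLin'_apply] using h)
  have hemb : MeasurableEmbedding (Matrix.toLin' M) :=
    (LinearMap.continuous_of_finiteDimensional _).measurableEmbedding hinj
  have h0 : ∀ x, Matrix.toLin' M x 0 = -ξ 0 / r * x 0 + ξ 1 / r * x 1 := by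
    intro x; simp [hM, Matrix.toLin'_apply, Matrix.mulVec, dotProduct, Fin.sum_univ_two]
  have h1 : ∀ x, Matrix.toLin' M x 1 = -ξ 1 / r * x 0 + -ξ 0 / r * x 1 := by
    intro x; simp [hM, Matrix.toLin'_apply, Matrix.mulVec, dotProduct, Fin.sum_univ_two]
  have hpre : Matrix.toLin' M ⁻¹' unitDisk = unitDisk := by
    ext x
    simp only [unitDisk, Set.mem_preimage, Set.mem_ofPred_eq, h0, h1]
    have : (-ξ 0 / r * x 0 + ξ 1 / r * x 1) ^ 2 + (-ξ 1 / r * x 0 + -ξ 0 / r * x 1) ^ 2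
        = x 0 ^ 2 + x 1 ^ 2 := by
      field_simp
      rw [hr2]; ring
    rw [this]
  unfold ftDisk
  rw [← hmap.setIntegral_preimage_emb hemb, hpre]
  refine integral_congr_ae (Filter.Eventually.of_forall fun x => ?_)
  simp only
  congr 1
  rw [h0, h1]
  have : ξ 0 * (-ξ 0 / r * x 0 + ξ 1 / r * x 1) + ξ 1 * (-ξ 1 / r * x 0 + -ξ 0 / r * x 1)
      = - (r * x 0) := by
    field_simp
    rw [hr2]; ring
  rw [this]
  push_cast
  ring

/-- Integrating a function of the first coordinate over the disk by slices. -/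
lemma integral_unitDisk_fst (g : ℝ → ℂ) (hg : Continuous g) :
    ∫ x in unitDisk, g (x 0) = 2 * ∫ s in (-1 : ℝ)..1, ((√(1 - s ^ 2) : ℝ) : ℂ) * g s := by
  set E : Set (ℝ × ℝ) := {p | p.1 ^ 2 + p.2 ^ 2 ≤ 1} with hE
  have hEm : MeasurableSet E := by apply measurableSet_le <;> fun_prop
  have hpre : MeasurableEquiv.finTwoArrow ⁻¹' E = unitDisk := by
    ext x; simp [hE, unitDisk, MeasurableEquiv.finTwoArrow]
  have hstep : ∫ x in unitDisk, g (x 0) = ∫ p in E, g p.1 := by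
    rw [← (volume_preserving_finTwoArrow ℝ).setIntegral_preimage_emb
      (MeasurableEquiv.measurableEmbedding _), hpre]
    rfl
  have hEc : IsCompact E := by
    refine Metric.isCompact_of_isClosed_isBounded (isClosed_le (by fun_prop) (by fun_prop)) ?_
    refine (Metric.isBounded_closedBall (x := (0 : ℝ × ℝ)) (r := 1)).subset ?_
    rintro ⟨a, b⟩ hab
    simp only [hE, Set.mem_ofPred_eq] at hab
    simp only [mem_closedBall_zero_iff, Prod.norm_def, Real.norm_eq_abs, sup_le_iff]
    exact ⟨abs_le_one_iff_mul_self_le_one.2 (by nlinarith [sq_nonneg b]),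
      abs_le_one_iff_mul_self_le_one.2 (by nlinarith [sq_nonneg a])⟩
  have hint : Integrable (E.indicator fun p : ℝ × ℝ => g p.1) (volume.prod volume) := by
    rw [integrable_indicator_iff hEm]
    exact (hg.comp continuous_fst).continuousOn.integrableOn_compact hEc
  rw [hstep, ← integral_indicator hEm, Measure.volume_eq_prod, integral_prod _ hint,
    intervalIntegral.integral_of_le (by norm_num), ← integral_Icc_eq_integral_Ioc,
    ← integral_indicator measurableSet_Icc, ← integral_const_mul]
  refine integral_congr_ae (Filter.Eventually.of_forall fun s => ?_)
  simp only
  by_cases hs : s ∈ Set.Icc (-1 : ℝ) 1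
  · rw [Set.indicator_of_mem hs]
    have h1 : 0 ≤ 1 - s ^ 2 := by nlinarith [hs.1, hs.2]
    have : (fun y => E.indicator (fun p : ℝ × ℝ => g p.1) (s, y))
        = (Set.Icc (-√(1 - s ^ 2)) (√(1 - s ^ 2))).indicator fun _ => g s := by
      ext y
      simp only [Set.indicator, hE, Set.mem_ofPred_eq, Set.mem_Icc]
      congr 1
      rw [← abs_le, ← Real.sqrt_sq_eq_abs, Real.sqrt_le_sqrt_iff h1]
      exact propext ⟨fun h => by linarith, fun h => by linarith⟩
    rw [this, integral_indicator measurableSet_Icc, setIntegral_const]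
    simp only [Measure.real, Real.volume_Icc, sub_neg_eq_add]
    rw [ENNReal.toReal_ofReal (by positivity), Complex.real_smul]
    push_cast
    ring
  · rw [Set.indicator_of_notMem hs, mul_zero]
    have : ∀ y, E.indicator (fun p : ℝ × ℝ => g p.1) (s, y) = 0 := by
      intro y
      refine Set.indicator_of_notMem ?_ _
      intro h
      simp only [hE, Set.mem_ofPred_eq] at h
      exact hs (abs_le.1 (abs_le_one_iff_mul_self_le_one.2 (by nlinarith [sq_nonneg y])))
    simp [this]

lemma ftDisk_eq_besselIntegral {ξ : Fin 2 → ℝ} (hξ : 0 < euc2 ξ) :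
    ftDisk ξ = 2 * besselIntegral (2 * Real.pi * euc2 ξ) := by
  rw [ftDisk_eq_rotate hξ, besselIntegral,
    integral_unitDisk_fst (fun s => Complex.exp (((2 * Real.pi * euc2 ξ : ℝ) : ℂ) * (s : ℝ) * I))
      (by fun_prop)]

/-- The integrand of the Bessel integral, continued analytically to the strip `|Re s| ≤ 1`,
`0 ≤ Im s`. -/
noncomputable def besselIntegrand (x : ℝ) (s : ℂ) : ℂ :=
  (1 - s ^ 2) ^ (2⁻¹ : ℂ) * Complex.exp (x * s * I)

lemma continuousAt_besselIntegrand (x : ℝ) {s : ℂ} (hs : |s.re| ≤ 1) :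
    ContinuousAt (besselIntegrand x) s := by
  have h1 := abs_le_one_iff_mul_self_le_one.1 hs
  have hre : 0 ≤ (1 - s ^ 2).re := by
    simp [pow_two]; nlinarith [mul_self_nonneg s.im]
  have h := Complex.continuousAt_cpow_const_of_re_pos (z := 1 - s ^ 2) (w := 2⁻¹) (Or.inl hre)
    (by norm_num)
  have h2 : ContinuousAt (fun s : ℂ => 1 - s ^ 2) s := by fun_prop
  exact (ContinuousAt.comp (f := fun s : ℂ => 1 - s ^ 2) (g := fun z : ℂ => z ^ (2⁻¹ : ℂ)) h h2).mul
    (by fun_prop)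

lemma differentiableAt_besselIntegrand (x : ℝ) {s : ℂ} (hs : |s.re| < 1) :
    DifferentiableAt ℂ (besselIntegrand x) s := by
  have h1 : s.re * s.re < 1 := by
    rw [← abs_mul_abs_self]; nlinarith [abs_nonneg s.re]
  have hre : 0 < (1 - s ^ 2).re := by
    simp [pow_two]; nlinarith [mul_self_nonneg s.im]
  unfold besselIntegrand
  refine DifferentiableAt.mul ?_ (by fun_prop)
  exact DifferentiableAt.cpow_const (by fun_prop) (Or.inl hre)

lemma cpow_inv_two_sq (z : ℂ) : (z ^ (2⁻¹ : ℂ)) ^ 2 = z :=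
  mod_cast Complex.cpow_nat_inv_pow z (n := 2) two_ne_zero

lemma norm_sq_cpow_inv_two (z : ℂ) : ‖z ^ (2⁻¹ : ℂ)‖ ^ 2 = ‖z‖ := by
  rw [← norm_pow, cpow_inv_two_sq]

lemma norm_besselIntegrand_le (x : ℝ) (s : ℂ) :
    ‖besselIntegrand x s‖ ≤ (1 + ‖s‖) * Real.exp (-(x * s.im)) := by
  have h1 : ‖(1 - s ^ 2) ^ (2⁻¹ : ℂ)‖ ≤ 1 + ‖s‖ := by
    rw [← pow_le_pow_iff_left₀ (norm_nonneg _) (by positivity) two_ne_zero]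
    rw [norm_sq_cpow_inv_two]
    calc ‖1 - s ^ 2‖ ≤ ‖(1 : ℂ)‖ + ‖s ^ 2‖ := norm_sub_le _ _
      _ = 1 + ‖s‖ ^ 2 := by simp
      _ ≤ _ := by nlinarith [norm_nonneg s]
  rw [besselIntegrand, norm_mul, Complex.norm_exp]
  have : ((x : ℂ) * s * I).re = -(x * s.im) := by simp
  rw [this]
  gcongr

/-- The contour of integration is moved from `[-1, 1]` to the other three sides of a rectangle. -/
lemma besselIntegral_eq_contour (x : ℝ) {H : ℝ} (hH : 0 < H) :
    besselIntegral x = (∫ s in (-1 : ℝ)..1, besselIntegrand x (s + H * I))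
      + 2 * ((∫ y in (0 : ℝ)..H, besselIntegrand x (1 + y * I)).im : ℂ) := by
  have key := Complex.integral_boundary_rect_eq_zero_of_continuousOn_of_differentiableOn
    (besselIntegrand x) (-1) (1 + H * I)
    (by
      intro s hs
      refine (continuousAt_besselIntegrand x ?_).continuousWithinAt
      have := hs.1
      simp only [neg_re, one_re, add_re, mul_re, ofReal_re, I_re, mul_zero, ofReal_im, I_im,
        Set.mem_preimage] at this
      norm_num at this
      exact abs_le.2 this)
    (by
      intro s hs
      refine (differentiableAt_besselIntegrand x ?_).differentiableWithinAt
      have := hs.1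
      simp only [neg_re, one_re, add_re, mul_re, ofReal_re, I_re, mul_zero, ofReal_im, I_im,
        Set.mem_preimage] at this
      norm_num at this
      exact abs_lt.2 this)
  have hbase : ∫ s in (-1 : ℝ)..1, besselIntegrand x s = besselIntegral x := by
    refine intervalIntegral.integral_congr fun s hs => ?_
    rw [Set.uIcc_of_le (by norm_num)] at hs
    have h1 : 0 ≤ 1 - s ^ 2 := by nlinarith [hs.1, hs.2]
    simp only [besselIntegrand]
    congr 1
    rw [Real.sqrt_eq_rpow, Complex.ofReal_cpow h1]
    norm_num
  have hconj : ∫ y in (0 : ℝ)..H, besselIntegrand x (-1 + y * I)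
      = (starRingEnd ℂ) (∫ y in (0 : ℝ)..H, besselIntegrand x (1 + y * I)) := by
    rw [intervalIntegral.integral_of_le hH.le, intervalIntegral.integral_of_le hH.le,
      ← integral_conj]
    refine setIntegral_congr_fun measurableSet_Ioc fun y hy => ?_
    have harg : (1 - (-1 + y * I) ^ 2 : ℂ).arg ≠ Real.pi := by
      refine (Complex.mem_slitPlane_iff_arg.1 (Or.inl ?_)).1
      simp [pow_two]
      nlinarith [hy.1]
    simp only [besselIntegrand, map_mul, ← Complex.exp_conj]
    congr 1
    · have h := Complex.cpow_conj _ 2⁻¹ harg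
      simp only [map_inv₀, map_ofNat] at h
      rw [h]
      congr 2
      simp
      ring
    · congr 1
      simp
      ring
  simp only [neg_re, one_re, add_re, mul_re, ofReal_re, I_re, mul_zero, ofReal_im, I_im, neg_im,
    one_im, add_im, mul_im, smul_eq_mul, sub_self, add_zero, neg_zero, ofReal_zero, zero_mul,
    mul_one, zero_add, ofReal_one, ofReal_neg] at key
  rw [hbase, hconj] at key
  set G := ∫ y in (0 : ℝ)..H, besselIntegrand x (1 + y * I)
  have hG : I * G - I * (starRingEnd ℂ) G = -2 * (G.im : ℂ) := by
    apply Complex.ext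
    · simp; ring
    · simp
  linear_combination key - hG

lemma integrableOn_rpow_mul_exp_neg_mul {x s : ℝ} (hx : 0 < x) (hs : -1 < s) :
    IntegrableOn (fun y : ℝ => y ^ s * Real.exp (-(x * y))) (Set.Ioi 0) := by
  have h := integrableOn_rpow_mul_exp_neg_mul_rpow (p := 1) hs one_pos hx
  simpa using h

lemma norm_besselIntegrand_one_add_le (x : ℝ) {y : ℝ} (hy : 0 < y) :
    ‖besselIntegrand x (1 + y * I)‖ ≤ (2 + y) * Real.exp (-(x * y)) := by
  refine (norm_besselIntegrand_le x _).trans ?_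
  have h1 : ‖(1 + y * I : ℂ)‖ ≤ 1 + y := by
    refine (norm_add_le _ _).trans ?_
    simp [abs_of_pos hy]
  have h2 : (1 + y * I : ℂ).im = y := by simp
  rw [h2]
  exact mul_le_mul_of_nonneg_right (by linarith) (Real.exp_nonneg _)

lemma integrableOn_besselIntegrand {x : ℝ} (hx : 0 < x) :
    IntegrableOn (fun y : ℝ => besselIntegrand x (1 + y * I)) (Set.Ioi 0) := by
  have h0 := integrableOn_rpow_mul_exp_neg_mul hx (s := 0) (by norm_num)
  have h1 := integrableOn_rpow_mul_exp_neg_mul hx (s := 1) (by norm_num)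
  refine Integrable.mono' ((h0.const_mul 2).add h1) ?_ ?_
  · refine Continuous.aestronglyMeasurable (continuous_iff_continuousAt.2 fun y => ?_)
    have := continuousAt_besselIntegrand x (s := 1 + y * I) (by simp)
    exact ContinuousAt.comp (f := fun y : ℝ => (1 + y * I : ℂ)) this (by fun_prop)
  · refine (ae_restrict_iff' measurableSet_Ioi).2 (Filter.Eventually.of_forall fun y hy => ?_)
    refine (norm_besselIntegrand_one_add_le x hy).trans (le_of_eq ?_)
    simp
    ring

lemma besselIntegral_eq_im {x : ℝ} (hx : 0 < x) :
    besselIntegral x = 2 * ((∫ y in Set.Ioi (0 : ℝ), besselIntegrand x (1 + y * I)).im : ℂ) := by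
  have htop : Filter.Tendsto
      (fun H : ℝ => ∫ s in (-1 : ℝ)..1, besselIntegrand x (s + H * I)) Filter.atTop (nhds 0) := by
    have hb : ∀ᶠ H : ℝ in Filter.atTop, ‖∫ s in (-1 : ℝ)..1, besselIntegrand x (s + H * I)‖
        ≤ (2 + H) * Real.exp (-(x * H)) * 2 := by
      filter_upwards [Filter.eventually_ge_atTop 0] with H hH
      refine (intervalIntegral.norm_integral_le_of_norm_le_const
        (C := (2 + H) * Real.exp (-(x * H))) fun s hs => ?_).trans (le_of_eq (by norm_num))
      rw [Set.uIoc_of_le (by norm_num)] at hs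
      refine (norm_besselIntegrand_le x _).trans ?_
      have h1 : ‖(s + H * I : ℂ)‖ ≤ 1 + H := by
        refine (norm_add_le _ _).trans ?_
        simp only [norm_mul, Complex.norm_real, Real.norm_eq_abs, abs_of_nonneg hH, norm_I, mul_one]
        gcongr
        exact abs_le.2 ⟨hs.1.le, hs.2⟩
      have h2 : (s + H * I : ℂ).im = H := by simp
      rw [h2]
      exact mul_le_mul_of_nonneg_right (by linarith) (Real.exp_nonneg _)
    refine squeeze_zero_norm' hb ?_
    have hxH : Filter.Tendsto (fun H : ℝ => x * H) Filter.atTop Filter.atTop :=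
      Filter.tendsto_id.const_mul_atTop hx
    have h0 := (Real.tendsto_pow_mul_exp_neg_atTop_nhds_zero 0).comp hxH
    have h1 := (Real.tendsto_pow_mul_exp_neg_atTop_nhds_zero 1).comp hxH
    have h := (h0.const_mul 4).add (h1.const_mul (2 / x))
    simp only [mul_zero, add_zero] at h
    refine h.congr fun H => ?_
    simp only [Function.comp_apply]
    field_simp
    ring
  have hmain := (MeasureTheory.intervalIntegral_tendsto_integral_Ioi 0
    (integrableOn_besselIntegrand hx) Filter.tendsto_id)
  have hlim := htop.add (((Complex.continuous_ofReal.comp Complex.continuous_im).tendsto _ |>.comp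
    hmain).const_mul 2)
  refine tendsto_nhds_unique (tendsto_const_nhds.congr' ?_) (hlim.trans (by simp))
  filter_upwards [Filter.eventually_gt_atTop 0] with H hH
  exact besselIntegral_eq_contour x hH

/-- The square root `q = √(y² - 2iy)` decomposed along the directions `e^{∓iπ/4}`. -/
lemma sqrt_phase_bounds {y : ℝ} (hy : 0 < y) {q : ℂ} (hq : q = (1 - (1 + y * I) ^ 2) ^ (2⁻¹ : ℂ)) :
    2 * y ^ (1 / 2 : ℝ) ≤ q.re - q.im ∧ 0 ≤ q.re + q.im ∧
      q.re + q.im ≤ 2⁻¹ * y ^ (3 / 2 : ℝ) := by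
  have hsq : q ^ 2 = 1 - (1 + y * I) ^ 2 := by
    rw [hq, cpow_inv_two_sq]
  have hre0 : 0 ≤ q.re := by
    rw [hq, Complex.cpow_inv_two_re]; positivity
  have h1 := congrArg Complex.re hsq
  have h2 := congrArg Complex.im hsq
  simp [pow_two] at h1 h2
  have hab : q.re * q.im = -y := by linarith
  have him : q.im < 0 := by
    by_contra h
    have h3 := mul_nonneg hre0 (not_lt.1 h)
    linarith
  have hP : 0 < q.re - q.im := by linarith
  have hPQ : (q.re - q.im) * (q.re + q.im) = y ^ 2 := by linear_combination h1
  have hP2 : (2 * √y) ^ 2 ≤ (q.re - q.im) ^ 2 := by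
    rw [mul_pow, Real.sq_sqrt hy.le]
    have h3 : (q.re - q.im) ^ 2 = (q.re + q.im) ^ 2 + 4 * y := by linear_combination (-4) * hab
    linarith [sq_nonneg (q.re + q.im)]
  have hs : 0 < √y := Real.sqrt_pos.2 hy
  have hP' : 2 * √y ≤ q.re - q.im := (pow_le_pow_iff_left₀ (by positivity) hP.le two_ne_zero).1 hP2
  have hQ : 0 < q.re + q.im := by
    by_contra h
    have h3 := mul_nonpos_of_nonneg_of_nonpos hP.le (not_lt.1 h)
    rw [hPQ] at h3
    exact absurd h3 (not_le.2 (by positivity))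
  have h32 : y ^ (3 / 2 : ℝ) = y * √y := by
    rw [show (3 / 2 : ℝ) = 1 + 1 / 2 by norm_num, Real.rpow_add hy, Real.rpow_one,
      Real.sqrt_eq_rpow]
  refine ⟨by rwa [← Real.sqrt_eq_rpow], hQ.le, ?_⟩
  rw [h32]
  have hyy : √y * √y = y := Real.mul_self_sqrt hy.le
  have : (2 * √y) * (q.re + q.im) ≤ y ^ 2 := by
    rw [← hPQ]; gcongr
  have h3 : (2 * √y) * (q.re + q.im) ≤ (2 * √y) * (2⁻¹ * (y * √y)) := by
    refine this.trans (le_of_eq ?_)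
    linear_combination (-y) * hyy
  exact le_of_mul_le_mul_left h3 (by positivity)

/-- At a zero of the Bessel integral the phase `x - π/4` is nearly a multiple of `π`. -/
lemma abs_sin_le_of_besselIntegral_eq_zero {x : ℝ} (hx : 0 < x) (h0 : besselIntegral x = 0) :
    |Real.sin (x - Real.pi / 4)| ≤ 3 / (8 * x) * |Real.cos (x - Real.pi / 4)| := by
  set h : ℝ → ℂ := fun y => Complex.exp (-(x * I)) * besselIntegrand x (1 + y * I) with hh
  have hform : ∀ y : ℝ, h y
      = ((Real.exp (-(x * y)) : ℝ) : ℂ) * (1 - (1 + y * I) ^ 2) ^ (2⁻¹ : ℂ) := by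
    intro y
    simp only [hh, besselIntegrand]
    rw [mul_left_comm, ← Complex.exp_add, mul_comm, Complex.ofReal_exp]
    congr 2
    push_cast
    linear_combination (x * y : ℂ) * I_mul_I
  have hint : IntegrableOn h (Set.Ioi 0) := (integrableOn_besselIntegrand hx).const_mul _
  have hre : IntegrableOn (fun y => (h y).re) (Set.Ioi 0) := hint.re
  have him : IntegrableOn (fun y => (h y).im) (Set.Ioi 0) := hint.im
  set W := ∫ y in Set.Ioi (0 : ℝ), h y with hW
  have hWre : W.re = ∫ y in Set.Ioi (0 : ℝ), (h y).re := (integral_re hint).symm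
  have hWim : W.im = ∫ y in Set.Ioi (0 : ℝ), (h y).im := (integral_im hint).symm
  have hP : 2 * ((1 / x) ^ (3 / 2 : ℝ) * Real.Gamma (3 / 2)) ≤ W.re - W.im := by
    rw [hWre, hWim, ← integral_sub hre him, ← Real.integral_rpow_mul_exp_neg_mul_Ioi (by norm_num) hx,
      ← integral_const_mul]
    refine setIntegral_mono_on ((integrableOn_rpow_mul_exp_neg_mul hx (by norm_num)).const_mul 2)
      (hre.sub him) measurableSet_Ioi fun y hy => ?_
    have hb := (sqrt_phase_bounds hy rfl).1
    rw [hform, re_ofReal_mul, im_ofReal_mul, show (3 / 2 - 1 : ℝ) = 1 / 2 by norm_num]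
    nlinarith [Real.exp_pos (-(x * y))]
  have hQ0 : 0 ≤ W.re + W.im := by
    rw [hWre, hWim, ← integral_add hre him]
    refine setIntegral_nonneg measurableSet_Ioi fun y hy => ?_
    have hb := (sqrt_phase_bounds hy rfl).2.1
    rw [hform, re_ofReal_mul, im_ofReal_mul, ← mul_add]
    exact mul_nonneg (Real.exp_nonneg _) hb
  have hQ : W.re + W.im ≤ 2⁻¹ * ((1 / x) ^ (5 / 2 : ℝ) * Real.Gamma (5 / 2)) := by
    rw [hWre, hWim, ← integral_add hre him, ← Real.integral_rpow_mul_exp_neg_mul_Ioi (by norm_num) hx,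
      ← integral_const_mul]
    refine setIntegral_mono_on (hre.add him)
      ((integrableOn_rpow_mul_exp_neg_mul hx (by norm_num)).const_mul _)
      measurableSet_Ioi fun y hy => ?_
    have hb := (sqrt_phase_bounds hy rfl).2.2
    rw [hform, re_ofReal_mul, im_ofReal_mul, show (5 / 2 - 1 : ℝ) = 3 / 2 by norm_num]
    nlinarith [Real.exp_pos (-(x * y))]
  have hx1 : 0 < 1 / x := by positivity
  have hΓ : Real.Gamma (5 / 2) = 3 / 2 * Real.Gamma (3 / 2) := by
    rw [show (5 / 2 : ℝ) = 3 / 2 + 1 by norm_num, Real.Gamma_add_one (by norm_num)]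
  have hpow : (1 / x) ^ (5 / 2 : ℝ) = (1 / x) ^ (3 / 2 : ℝ) * (1 / x) := by
    rw [show (5 / 2 : ℝ) = 3 / 2 + 1 by norm_num, Real.rpow_add hx1, Real.rpow_one]
  have hpos : 0 < (1 / x) ^ (3 / 2 : ℝ) * Real.Gamma (3 / 2) :=
    mul_pos (Real.rpow_pos_of_pos hx1 _) (Real.Gamma_pos_of_pos (by norm_num))
  set T := (1 / x) ^ (3 / 2 : ℝ) * Real.Gamma (3 / 2)
  have hQ' : W.re + W.im ≤ 3 / (8 * x) * (W.re - W.im) := by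
    refine hQ.trans ?_
    have : 2⁻¹ * ((1 / x) ^ (5 / 2 : ℝ) * Real.Gamma (5 / 2)) = 3 / (8 * x) * (2 * T) := by
      rw [hΓ, hpow]; simp only [T]; field_simp; norm_num
    rw [this]
    gcongr
  have hzero : Real.cos x * W.im + Real.sin x * W.re = 0 := by
    rw [besselIntegral_eq_im hx] at h0
    have h1 : (∫ y in Set.Ioi (0 : ℝ), besselIntegrand x (1 + y * I)) = Complex.exp (x * I) * W := by
      rw [hW, hh, integral_const_mul, ← mul_assoc, ← Complex.exp_add]
      simp
    rw [h1] at h0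
    have h2 : (Complex.exp (x * I) * W).im = 0 := by
      exact_mod_cast (mul_eq_zero.1 h0).resolve_left two_ne_zero
    rw [Complex.mul_im, Complex.exp_ofReal_mul_I_re, Complex.exp_ofReal_mul_I_im] at h2
    exact h2
  have hPpos : 0 < W.re - W.im := by linarith
  have hphase : Real.sin (x - Real.pi / 4) * (W.re - W.im)
      = -(Real.cos (x - Real.pi / 4) * (W.re + W.im)) := by
    rw [Real.sin_sub, Real.cos_sub, Real.sin_pi_div_four, Real.cos_pi_div_four]
    linear_combination √2 * hzero
  have habs := congrArg abs hphase
  rw [abs_neg, abs_mul, abs_mul, abs_of_pos hPpos, abs_of_nonneg hQ0] at habs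
  refine le_of_mul_le_mul_right ?_ hPpos
  rw [habs, mul_right_comm, mul_comm (3 / (8 * x) * _)]
  gcongr

/-- A number whose tangent is small is close to a multiple of `π`. -/
lemma exists_int_abs_sub_mul_pi_le {δ ε : ℝ} (h : |Real.sin δ| ≤ ε * |Real.cos δ|) :
    ∃ n : ℤ, |δ - n * Real.pi| ≤ ε := by
  refine ⟨round (δ / Real.pi), ?_⟩
  set n := round (δ / Real.pi)
  set η := δ - n * Real.pi with hη
  have hpi := Real.pi_pos
  have hηle : |η| ≤ Real.pi / 2 := by
    have h1 := abs_sub_round (δ / Real.pi)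
    have h2 : η = (δ / Real.pi - n) * Real.pi := by rw [hη]; field_simp
    rw [h2, abs_mul, abs_of_pos hpi]
    nlinarith
  have hs : |Real.sin η| = |Real.sin δ| := by
    rw [hη, Real.sin_sub_int_mul_pi, abs_mul]
    simp
  have hc : |Real.cos η| = |Real.cos δ| := by
    rw [hη, Real.cos_sub_int_mul_pi, abs_mul]
    simp
  rw [← hs, ← hc] at h
  have hs' : |Real.sin η| = Real.sin |η| := by
    rcases abs_cases η with ⟨h1, h2⟩ | ⟨h1, h2⟩
    · rw [h1] at hηle ⊢
      exact abs_of_nonneg (Real.sin_nonneg_of_nonneg_of_le_pi h2 (by linarith))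
    · rw [h1] at hηle ⊢
      rw [← abs_neg, ← Real.sin_neg]
      exact abs_of_nonneg (Real.sin_nonneg_of_nonneg_of_le_pi (by linarith) (by linarith))
  rw [hs', ← Real.cos_abs] at h
  rcases hηle.eq_or_lt with h1 | h1
  · rw [h1] at h
    simp at h
    linarith
  · have hcpos : 0 < Real.cos |η| :=
      Real.cos_pos_of_mem_Ioo ⟨by linarith [abs_nonneg η], h1⟩
    rw [abs_of_pos hcpos] at h
    have h2 : Real.tan |η| ≤ ε := by
      rw [Real.tan_eq_sin_div_cos, div_le_iff₀ hcpos]; exact h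
    exact (Real.le_tan (abs_nonneg η) h1).trans h2

lemma besselIntegral_ne_zero {x : ℝ} (hx : 0 ≤ x) (hx' : x ≤ Real.pi / 2) :
    besselIntegral x ≠ 0 := by
  intro h
  have hcont : Continuous fun s : ℝ => ((√(1 - s ^ 2) : ℝ) : ℂ) * Complex.exp (x * s * I) := by
    fun_prop
  have hpos : 0 < ∫ s in (-1 : ℝ)..1, √(1 - s ^ 2) * Real.cos (x * s) := by
    refine intervalIntegral.intervalIntegral_pos_of_pos_on
      (Continuous.intervalIntegrable (by fun_prop) _ _) (fun s hs => ?_) (by norm_num)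
    refine mul_pos (Real.sqrt_pos.2 (by nlinarith [hs.1, hs.2])) ?_
    refine Real.cos_pos_of_mem_Ioo ⟨?_, ?_⟩
    · nlinarith [hs.1, hs.2, Real.pi_pos]
    · nlinarith [hs.1, hs.2, Real.pi_pos]
  have hre : (besselIntegral x).re = ∫ s in (-1 : ℝ)..1, √(1 - s ^ 2) * Real.cos (x * s) := by
    unfold besselIntegral
    rw [← Complex.reCLM_apply,
      ← ContinuousLinearMap.intervalIntegral_comp_comm _ (hcont.intervalIntegrable _ _)]
    refine intervalIntegral.integral_congr fun s _ => ?_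
    simp only [Complex.reCLM_apply, re_ofReal_mul]
    rw [← Complex.ofReal_mul, Complex.exp_ofReal_mul_I_re]
  rw [h] at hre
  simp at hre
  linarith

/-- The lengths of the zeros of the Fourier transform of the disk are at least `1/2`, and they are
`1/8` plus a half-integer up to a small error. -/
lemma euc2_of_ftDisk_eq_zero {ξ : Fin 2 → ℝ} (hξ : 0 < euc2 ξ) (h : ftDisk ξ = 0) :
    1 / 2 ≤ euc2 ξ ∧ ∃ k : ℤ, |euc2 ξ - 1 / 8 - k / 2| ≤ 1 / (100 * euc2 ξ) := by
  rw [ftDisk_eq_besselIntegral hξ] at h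
  set r := euc2 ξ
  have h0 : besselIntegral (2 * Real.pi * r) = 0 := by simpa using h
  have hpi := Real.pi_gt_d2
  have hr4 : 1 / 4 < r := by
    by_contra hr
    exact besselIntegral_ne_zero (by positivity) (by nlinarith) h0
  obtain ⟨n, hn⟩ := exists_int_abs_sub_mul_pi_le
    (abs_sin_le_of_besselIntegral_eq_zero (by positivity) h0)
  have hn' : |r - 1 / 8 - n / 2| ≤ 1 / (100 * r) := by
    have h1 : 2 * Real.pi * r - Real.pi / 4 - n * Real.pi
        = (2 * Real.pi) * (r - 1 / 8 - n / 2) := by ring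
    rw [h1, abs_mul, abs_of_pos (by positivity)] at hn
    have h2 : (2 * Real.pi) * |r - 1 / 8 - n / 2| * (8 * (2 * Real.pi * r)) ≤ 3 := by
      rwa [le_div_iff₀ (by positivity)] at hn
    rw [le_div_iff₀ (by positivity)]
    have h3 : 0 ≤ |r - 1 / 8 - n / 2| * r := by positivity
    nlinarith [mul_nonneg h3 (show 0 ≤ Real.pi ^ 2 - 9.8 by nlinarith)]
  refine ⟨?_, n, hn'⟩
  have h1 : 1 / (100 * r) ≤ 1 / 25 := by
    rw [div_le_div_iff₀ (by positivity) (by norm_num)]; linarith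
  have h2 := abs_le.1 (hn'.trans h1)
  have hn1 : 1 ≤ n := by
    by_contra hc
    have : (n : ℝ) ≤ 0 := by exact_mod_cast (by omega : n ≤ 0)
    linarith [h2.2]
  have : (1 : ℝ) ≤ n := by exact_mod_cast hn1
  linarith [h2.1]

/-- All distances between distinct points of `S` are `1/8` plus a half-integer, up to an error
inversely proportional to the distance. -/
def HasBesselDistances (S : Set ℂ) : Prop :=
  ∀ z ∈ S, ∀ w ∈ S, z ≠ w →
    1 / 2 ≤ ‖z - w‖ ∧ ∃ k : ℤ, |‖z - w‖ - 1 / 8 - k / 2| ≤ 1 / (100 * ‖z - w‖)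

lemma HasBesselDistances.exists_int {S : Set ℂ} (hS : HasBesselDistances S) {z w : ℂ} (hz : z ∈ S)
    (hw : w ∈ S) (hzw : z ≠ w) : ∃ k : ℤ, |‖z - w‖ - 1 / 8 - k / 2| ≤ 1 / 50 := by
  obtain ⟨h1, k, hk⟩ := hS z hz w hw hzw
  refine ⟨k, hk.trans ?_⟩
  rw [div_le_div_iff₀ (by positivity) (by norm_num)]
  linarith

/-- The triangle inequality is never close to an equality. -/
lemma HasBesselDistances.le_excess {S : Set ℂ} (hS : HasBesselDistances S) {z w v : ℂ}
    (hz : z ∈ S) (hw : w ∈ S) (hv : v ∈ S) (hzw : z ≠ w) (hwv : w ≠ v) (hzv : z ≠ v) :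
    ‖z - v‖ + 1 / 16 ≤ ‖z - w‖ + ‖w - v‖ := by
  obtain ⟨i, hi⟩ := hS.exists_int hz hw hzw
  obtain ⟨j, hj⟩ := hS.exists_int hw hv hwv
  obtain ⟨k, hk⟩ := hS.exists_int hz hv hzv
  have htri := norm_sub_le_norm_sub_add_norm_sub z w v
  rw [abs_le] at hi hj hk
  have h1 : k ≤ i + j := by
    by_contra h
    have : (i : ℝ) + j + 1 ≤ k := by exact_mod_cast (by omega : i + j + 1 ≤ k)
    linarith [hi.2, hj.2, hk.1]
  have h2 : (k : ℝ) ≤ i + j := by exact_mod_cast h1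
  linarith [hi.1, hj.1, hk.2]

lemma card_Icc_floor_le {α β : ℝ} (h : α ≤ β) :
    ((Finset.Icc ⌊α⌋ ⌊β⌋).card : ℝ) ≤ β - α + 2 := by
  have h1 : ⌊α⌋ ≤ ⌊β⌋ := Int.floor_le_floor h
  have h2 : ((Finset.Icc ⌊α⌋ ⌊β⌋).card : ℤ) = ⌊β⌋ + 1 - ⌊α⌋ := by
    rw [Int.card_Icc, Int.toNat_of_nonneg (by omega)]
  have h3 : ((Finset.Icc ⌊α⌋ ⌊β⌋).card : ℝ) = ⌊β⌋ + 1 - ⌊α⌋ := by exact_mod_cast h2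
  rw [h3]
  linarith [Int.floor_le β, Int.lt_floor_add_one α]

lemma abs_sub_lt_of_floor_eq {x y σ : ℝ} (hσ : 0 < σ) (h : ⌊x / σ⌋ = ⌊y / σ⌋) : |x - y| < σ := by
  have := Int.abs_sub_lt_one_of_floor_eq_floor h
  rwa [← sub_div, abs_div, abs_of_pos hσ, div_lt_one hσ] at this

/-- A separated set in a square is no larger than the area allows. -/
lemma card_le_of_separated {σ R : ℝ} (hσ : 0 < σ) (hR : 0 ≤ R) (F : Finset ℂ)
    (hsep : ∀ z ∈ F, ∀ w ∈ F, z ≠ w → σ ≤ ‖z - w‖) (hF : ∀ z ∈ F, |z.re| ≤ R ∧ |z.im| ≤ R) :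
    (F.card : ℝ) ≤ (4 * R / σ + 2) ^ 2 := by
  have hσ2 : 0 < σ / 2 := by positivity
  set J := Finset.Icc ⌊-R / (σ / 2)⌋ ⌊R / (σ / 2)⌋
  have hcard : F.card ≤ (J ×ˢ J).card := by
    refine Finset.card_le_card_of_injOn (fun z => (⌊z.re / (σ / 2)⌋, ⌊z.im / (σ / 2)⌋)) ?_ ?_
    · intro z hz
      obtain ⟨h1, h2⟩ := hF z hz
      rw [abs_le] at h1 h2
      simp only [J, Finset.coe_product, Finset.coe_Icc, Set.mem_prod, Set.mem_Icc]
      refine ⟨⟨?_, ?_⟩, ?_, ?_⟩ <;> apply Int.floor_le_floor <;> gcongr <;> linarith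
    · intro z hz w hw hzw
      simp only [Prod.mk.injEq] at hzw
      by_contra hne
      have h1 := abs_sub_lt_of_floor_eq hσ2 hzw.1
      have h2 := abs_sub_lt_of_floor_eq hσ2 hzw.2
      have h3 := hsep z hz w hw hne
      have h4 := Complex.norm_le_abs_re_add_abs_im (z - w)
      simp only [sub_re, sub_im] at h4
      linarith
  have hJ : (J.card : ℝ) ≤ 4 * R / σ + 2 := by
    refine (card_Icc_floor_le (by gcongr; linarith)).trans (le_of_eq ?_)
    field_simp
    ring
  calc (F.card : ℝ) ≤ ((J ×ˢ J).card : ℝ) := by exact_mod_cast hcard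
    _ = (J.card : ℝ) ^ 2 := by rw [Finset.card_product]; push_cast; ring
    _ ≤ _ := by gcongr

lemma le_add_of_sq_eq_sq_add_sq {x p q σ : ℝ} (h : x ^ 2 = p ^ 2 + q ^ 2) (hp : 0 ≤ p)
    (hσ : 0 < σ) (hx : σ ≤ x) (hq : q ^ 2 ≤ σ / 50) : x ≤ p + 1 / 50 := by
  by_contra hc
  have h1 : 1 / 50 < x - p := by linarith
  have h2 : (x - p) * (x + p) = q ^ 2 := by linear_combination h
  nlinarith [mul_lt_mul_of_pos_right h1 (show 0 < x + p by linarith)]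

/-- Three points of a set with Bessel distances do not fit into a thin strip. Here `(v z, w z)` are
Cartesian coordinates along and across the strip. -/
lemma HasBesselDistances.false_of_thin {S : Set ℂ} (hS : HasBesselDistances S) {σ : ℝ} (hσ : 0 < σ)
    (hsep : ∀ z ∈ S, ∀ z' ∈ S, z ≠ z' → σ ≤ ‖z - z'‖) (v w : ℂ → ℝ) {z₁ z₂ z₃ : ℂ}
    (h₁ : z₁ ∈ S) (h₂ : z₂ ∈ S) (h₃ : z₃ ∈ S) (h₁₂ : z₁ ≠ z₂) (h₂₃ : z₂ ≠ z₃) (h₁₃ : z₁ ≠ z₃)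
    (hiso : ∀ z ∈ ({z₁, z₂, z₃} : Set ℂ), ∀ z' ∈ ({z₁, z₂, z₃} : Set ℂ),
      ‖z - z'‖ ^ 2 = (v z - v z') ^ 2 + (w z - w z') ^ 2)
    (hw : ∀ z ∈ ({z₁, z₂, z₃} : Set ℂ), ∀ z' ∈ ({z₁, z₂, z₃} : Set ℂ), (w z - w z') ^ 2 ≤ σ / 50) :
    False := by
  have main : ∀ p ∈ ({z₁, z₂, z₃} : Set ℂ), ∀ q ∈ ({z₁, z₂, z₃} : Set ℂ),
      ∀ r ∈ ({z₁, z₂, z₃} : Set ℂ), p ∈ S → q ∈ S → r ∈ S → p ≠ q → q ≠ r → p ≠ r →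
      v p ≤ v q → v q ≤ v r → False := by
    intro p hp q hq r hr hpS hqS hrS hpq hqr hpr h1 h2
    have e1 := le_add_of_sq_eq_sq_add_sq (p := v q - v p) (q := w p - w q)
      ((hiso p hp q hq).trans (by ring)) (by linarith) hσ (hsep p hpS q hqS hpq) (hw p hp q hq)
    have e2 := le_add_of_sq_eq_sq_add_sq (p := v r - v q) (q := w q - w r)
      ((hiso q hq r hr).trans (by ring)) (by linarith) hσ (hsep q hqS r hrS hqr) (hw q hq r hr)
    have e3 : v r - v p ≤ ‖p - r‖ :=
      (pow_le_pow_iff_left₀ (by linarith) (norm_nonneg _) two_ne_zero).1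
        (by nlinarith [hiso p hp r hr, sq_nonneg (w p - w r)])
    have e4 := hS.le_excess hpS hqS hrS hpq hqr hpr
    linarith
  have m1 : z₁ ∈ ({z₁, z₂, z₃} : Set ℂ) := by simp
  have m2 : z₂ ∈ ({z₁, z₂, z₃} : Set ℂ) := by simp
  have m3 : z₃ ∈ ({z₁, z₂, z₃} : Set ℂ) := by simp
  rcases le_total (v z₁) (v z₂) with a | a <;> rcases le_total (v z₂) (v z₃) with b | b <;>
    rcases le_total (v z₁) (v z₃) with c | c
  · exact main z₁ m1 z₂ m2 z₃ m3 h₁ h₂ h₃ h₁₂ h₂₃ h₁₃ a b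
  · exact main z₁ m1 z₂ m2 z₃ m3 h₁ h₂ h₃ h₁₂ h₂₃ h₁₃ a b
  · exact main z₁ m1 z₃ m3 z₂ m2 h₁ h₃ h₂ h₁₃ h₂₃.symm h₁₂ c b
  · exact main z₃ m3 z₁ m1 z₂ m2 h₃ h₁ h₂ h₁₃.symm h₁₂ h₂₃.symm c a
  · exact main z₂ m2 z₁ m1 z₃ m3 h₂ h₁ h₃ h₁₂.symm h₁₃ h₂₃ a c
  · exact main z₂ m2 z₃ m3 z₁ m1 h₂ h₃ h₁ h₂₃ h₁₃.symm h₁₂.symm b c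
  · exact main z₃ m3 z₂ m2 z₁ m1 h₃ h₂ h₁ h₂₃.symm h₁₂.symm h₁₃.symm b a
  · exact main z₃ m3 z₂ m2 z₁ m1 h₃ h₂ h₁ h₂₃.symm h₁₂.symm h₁₃.symm b a

/-- A point `(X, Y)` far from the foci of a hyperbola and close to that hyperbola has nearly the
direction of one of its asymptotes. Here `A`, `B` are the distances of `(X, Y)` to the foci
`(∓ t / 2, 0)`. -/
lemma abs_sub_mul_le_of_hyperbola {s t X Y ρ A B κ C S : ℝ} (hs : 0 < s) (hst : s ^ 2 = t) (ht2 : 1 / 2 ≤ t)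
    (hρ0 : 0 < ρ) (hρ : ρ ^ 2 = X ^ 2 + Y ^ 2) (hA0 : 0 ≤ A) (hB0 : 0 ≤ B)
    (hA : A ^ 2 = (X + t / 2) ^ 2 + Y ^ 2) (hB : B ^ 2 = (X - t / 2) ^ 2 + Y ^ 2)
    (hAB : |A - B| ≤ t) (hfar : 2 * s * t ≤ ρ)
    (hκ : |A - B - κ| ≤ 1 / (25 * ρ)) (hκt : |κ| ≤ t - 1 / 10) (hC : κ = C * t)
    (hS0 : 0 ≤ S) (hS : S ^ 2 = 1 - C ^ 2) :
    0 < S ∧ 3 * |X - C * ρ| ≤ 2 * s * S := by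
  have ht : 0 < t := by linarith
  have hs1 : 1 / 2 ≤ s := by
    by_contra h
    nlinarith
  have htρ : t ≤ ρ := by nlinarith
  set d := A - B with hd
  set e := d - κ with he
  have hη : (A + B) ^ 2 = 4 * ρ ^ 2 + t ^ 2 - d ^ 2 := by
    rw [hd]; linear_combination 2 * hA + 2 * hB - 4 * hρ
  have hX : 2 * t * X = d * (A + B) := by rw [hd]; linear_combination hB - hA
  have hd2 : d ^ 2 ≤ t ^ 2 := sq_le_sq' (abs_le.1 hAB).1 (abs_le.1 hAB).2
  set η := A + B - 2 * ρ with hη'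
  have hηeq : η * (A + B + 2 * ρ) = t ^ 2 - d ^ 2 := by rw [hη']; linear_combination hη
  have hη0 : 0 ≤ η :=
    nonneg_of_mul_nonneg_left (hηeq.symm ▸ sub_nonneg.2 hd2) (by linarith)
  have hηle : η * (4 * ρ) ≤ t ^ 2 - d ^ 2 := by
    rw [← hηeq]
    exact mul_le_mul_of_nonneg_left (by linarith) hη0
  set δ := X - C * ρ with hδ
  have hδeq : 2 * t * δ = 2 * ρ * e + d * η := by
    rw [hδ, he, hη']; linear_combination hX + 2 * ρ * hC
  have hκ' : ρ * |e| ≤ 1 / 25 := by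
    rw [le_div_iff₀ (by positivity)] at hκ
    linarith
  have het : t * |e| ≤ 1 / 25 := (mul_le_mul_of_nonneg_right htρ (abs_nonneg e)).trans hκ'
  have hδle : 2 * t * |δ| ≤ 2 / 25 + t * η := by
    calc 2 * t * |δ| = |2 * t * δ| := by rw [abs_mul, abs_of_pos (by positivity : 0 < 2 * t)]
      _ ≤ |2 * ρ * e| + |d * η| := by rw [hδeq]; exact abs_add_le _ _
      _ = 2 * (ρ * |e|) + |d| * η := by
        rw [abs_mul, abs_of_pos (by positivity : 0 < 2 * ρ), abs_mul, abs_of_nonneg hη0]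
        ring
      _ ≤ _ := by linarith [mul_le_mul_of_nonneg_right hAB hη0]
  have hκ2 : t ^ 2 - κ ^ 2 = t ^ 2 * S ^ 2 := by rw [hS, hC]; ring
  have hκle : |κ| ≤ t := by linarith
  have hdd : t ^ 2 - d ^ 2 ≤ t ^ 2 * S ^ 2 + 2 / 25 := by
    have h1 : κ ^ 2 - d ^ 2 ≤ |e| * |κ + d| := by
      rw [← abs_mul]
      refine le_trans (le_of_eq ?_) (neg_abs_le _ |> neg_le.1)
      rw [he]; ring
    have h2 : |e| * |κ + d| ≤ |e| * (2 * t) :=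
      mul_le_mul_of_nonneg_left ((abs_add_le _ _).trans (by linarith)) (abs_nonneg e)
    linarith
  have hηle' : η * (8 * s * t) ≤ t ^ 2 * S ^ 2 + 2 / 25 := by
    linarith [mul_le_mul_of_nonneg_left hfar hη0]
  have hS1 : S ≤ 1 := (sq_le_one_iff₀ hS0).1 (by linarith [sq_nonneg C])
  have htS : 18 / 100 * t ≤ t ^ 2 * S ^ 2 := by
    have := sq_le_sq' (abs_le.1 hκt).1 (abs_le.1 hκt).2
    rw [← hκ2]
    linarith
  have htS' : 42 / 100 * s ≤ t * S := by
    refine (pow_le_pow_iff_left₀ (by positivity) (by positivity) two_ne_zero).1 ?_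
    rw [mul_pow, mul_pow, hst]
    linarith
  have hSpos : 0 < S := by
    by_contra h
    rw [le_antisymm (not_lt.1 h) hS0, mul_zero] at htS'
    linarith
  refine ⟨hSpos, ?_⟩
  have h1 : 16 * s * (t * |δ|) ≤ 16 / 25 * s + t ^ 2 * S ^ 2 + 2 / 25 := by
    linarith [mul_le_mul_of_nonneg_left hδle (by positivity : 0 ≤ 8 * s)]
  have h2 : t ^ 2 * S ^ 2 ≤ t ^ 2 * S := by
    rw [sq S]
    exact mul_le_mul_of_nonneg_left (mul_le_of_le_one_left hS0 hS1) (by positivity)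
  have h3 : 42 / 100 * s * t ≤ t ^ 2 * S := by
    linarith [mul_le_mul_of_nonneg_right htS' ht.le]
  have h4 : s * (1 / 2) ≤ s * t := mul_le_mul_of_nonneg_left ht2 hs.le
  have h5 : s * t * (2 * s * S) = 2 * (t ^ 2 * S) := by rw [← hst]; ring
  refine le_of_mul_le_mul_left (a := s * t) ?_ (by positivity)
  rw [h5]
  linarith

/-- A point far from the foci of a hyperbola and close to that hyperbola is close to one of its
asymptotes. -/
lemma abs_asymptote_le {s t X Y ρ A B κ C S : ℝ} (hs : 0 < s) (hst : s ^ 2 = t) (ht2 : 1 / 2 ≤ t)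
    (hY : 0 ≤ Y) (hρ0 : 0 < ρ) (hρ : ρ ^ 2 = X ^ 2 + Y ^ 2) (hA0 : 0 ≤ A) (hB0 : 0 ≤ B)
    (hA : A ^ 2 = (X + t / 2) ^ 2 + Y ^ 2) (hB : B ^ 2 = (X - t / 2) ^ 2 + Y ^ 2)
    (hAB : |A - B| ≤ t) (hfar : 2 * s * t ≤ ρ)
    (hκ : |A - B - κ| ≤ 1 / (25 * ρ)) (hκt : |κ| ≤ t - 1 / 10) (hC : κ = C * t)
    (hS0 : 0 ≤ S) (hS : S ^ 2 = 1 - C ^ 2) :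
    |S * X - C * Y| ≤ 2 * s := by
  obtain ⟨hSpos, h3δ⟩ :=
    abs_sub_mul_le_of_hyperbola hs hst ht2 hρ0 hρ hA0 hB0 hA hB hAB hfar hκ hκt hC hS0 hS
  set δ := X - C * ρ with hδ
  have hS1 : S ≤ 1 := (sq_le_one_iff₀ hS0).1 (by linarith [sq_nonneg C])
  have hprod : |S * ρ - Y| * (S * ρ + Y) ≤ |δ| * (2 * ρ) := by
    have h1 : |S * ρ - Y| * (S * ρ + Y) = |δ| * |X + C * ρ| := by
      rw [← abs_of_nonneg (by positivity : 0 ≤ S * ρ + Y), ← abs_mul, ← abs_mul, hδ]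
      congr 1
      linear_combination ρ ^ 2 * hS + hρ
    rw [h1]
    refine mul_le_mul_of_nonneg_left ((abs_add_le _ _).trans ?_) (abs_nonneg δ)
    have h2 : |X| ≤ ρ := abs_le_of_sq_le_sq (by nlinarith) hρ0.le
    have h3 : |C| ≤ 1 := abs_le_of_sq_le_sq (by nlinarith) zero_le_one
    rw [abs_mul, abs_of_pos hρ0]
    nlinarith
  have hSρ : S * |S * ρ - Y| ≤ 2 * |δ| := by
    refine le_of_mul_le_mul_right ?_ hρ0
    have := mul_le_mul_of_nonneg_left (show S * ρ ≤ S * ρ + Y by linarith) (abs_nonneg (S * ρ - Y))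
    linarith
  have hC1 : |C| ≤ 1 := abs_le_of_sq_le_sq (by nlinarith) zero_le_one
  have hw : |S * X - C * Y| ≤ S * |δ| + |C| * |S * ρ - Y| := by
    have : S * X - C * Y = S * δ + C * (S * ρ - Y) := by rw [hδ]; ring
    rw [this]
    refine (abs_add_le _ _).trans (le_of_eq ?_)
    rw [abs_mul, abs_mul, abs_of_pos hSpos]
  refine le_of_mul_le_mul_left ?_ hSpos
  have h4 : S * (S * |δ|) ≤ |δ| := by
    rw [← mul_assoc]
    exact mul_le_of_le_one_left (abs_nonneg _) (by nlinarith)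
  have h5 : S * (|C| * |S * ρ - Y|) ≤ S * |S * ρ - Y| :=
    mul_le_mul_of_nonneg_left (mul_le_of_le_one_left (abs_nonneg _) hC1) hS0
  have h6 := mul_le_mul_of_nonneg_left hw hS0
  linarith

lemma HasBesselDistances.exists_asymptote {S : Set ℂ} (hS : HasBesselDistances S) {s : ℝ}
    (hs : 0 < s) (ha : ((-(s ^ 2 / 2) : ℝ) : ℂ) ∈ S) (hb : ((s ^ 2 / 2 : ℝ) : ℂ) ∈ S)
    (hs2 : 1 / 2 ≤ s ^ 2) {z : ℂ} (hz : z ∈ S) (hfar : 2 * s ^ 3 < ‖z‖) :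
    ∃ k : ℤ, |(k : ℝ)| ≤ 2 * s ^ 2 ∧
      |(√(1 - (k / (2 * s ^ 2)) ^ 2) * z.re - k / (2 * s ^ 2) * |z.im|)| ≤ 2 * s := by
  set t := s ^ 2 with ht
  have ht0 : 0 < t := by positivity
  have hs1 : 1 / 2 ≤ s := by
    by_contra h
    nlinarith
  have hfar' : 2 * s * t < ‖z‖ := by
    rw [ht]
    linarith [show 2 * s ^ 3 = 2 * s * s ^ 2 by ring]
  have htz : t < ‖z‖ := by nlinarith
  have hre : ∀ r : ℝ, |r| = t / 2 → z ≠ (r : ℂ) ∧ ‖z‖ / 2 ≤ ‖z - r‖ ∧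
      ‖z - r‖ ^ 2 = (z.re - r) ^ 2 + |z.im| ^ 2 := by
    intro r hr
    have h1 : ‖(r : ℂ)‖ = t / 2 := by rw [Complex.norm_real, Real.norm_eq_abs, hr]
    refine ⟨?_, ?_, ?_⟩
    · rintro rfl
      linarith
    · linarith [norm_sub_norm_le z r]
    · rw [← Complex.normSq_eq_norm_sq, Complex.normSq_apply, sq_abs]
      simp only [sub_re, sub_im, ofReal_re, ofReal_im]
      ring
  obtain ⟨na, la, ea⟩ := hre (-(t / 2)) (by rw [abs_neg, abs_of_pos (by positivity)])
  obtain ⟨nb, lb, eb⟩ := hre (t / 2) (abs_of_pos (by positivity))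
  obtain ⟨-, k₁, hk₁⟩ := hS _ hz _ ha na
  obtain ⟨-, k₂, hk₂⟩ := hS _ hz _ hb nb
  have hab : ((-(t / 2) : ℝ) : ℂ) ≠ ((t / 2 : ℝ) : ℂ) := by
    intro h
    linarith [Complex.ofReal_injective h]
  have hdist : ‖((-(t / 2) : ℝ) : ℂ) - ((t / 2 : ℝ) : ℂ)‖ = t := by
    rw [← Complex.ofReal_sub, Complex.norm_real, Real.norm_eq_abs, abs_sub_comm,
      abs_of_nonneg (by linarith)]
    ring
  obtain ⟨k₀, hk₀⟩ := hS.exists_int ha hb hab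
  rw [hdist] at hk₀
  set A := ‖z - ((-(t / 2) : ℝ) : ℂ)‖ with hA
  set B := ‖z - ((t / 2 : ℝ) : ℂ)‖ with hB
  have hz0 : 0 < ‖z‖ := by linarith
  have hAB : |A - B| ≤ t := by
    refine (abs_norm_sub_norm_le _ _).trans (le_of_eq ?_)
    rw [sub_sub_sub_cancel_left, norm_sub_rev, hdist]
  have hκ : |A - B - ((k₁ - k₂ : ℤ) : ℝ) / 2| ≤ 1 / (25 * ‖z‖) := by
    have h1 : ∀ x : ℝ, ‖z‖ / 2 ≤ x → 1 / (100 * x) ≤ 1 / (50 * ‖z‖) := fun x hx =>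
      one_div_le_one_div_of_le (by positivity) (by linarith)
    have h2 : 1 / (25 * ‖z‖) = 1 / (50 * ‖z‖) + 1 / (50 * ‖z‖) := by field_simp; norm_num
    have h3 := h1 A la
    have h4 := h1 B lb
    rw [abs_le] at hk₁ hk₂ ⊢
    push_cast
    constructor <;> linarith
  have hκ' : 1 / (25 * ‖z‖) ≤ 2 / 25 := by
    rw [div_le_div_iff₀ (by positivity) (by norm_num)]
    linarith
  have hkk : |((k₁ - k₂ : ℤ) : ℝ) / 2| ≤ t - 1 / 10 := by
    rw [abs_le] at hκ hk₀ hAB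
    have h1 : k₁ - k₂ ≤ k₀ := by
      by_contra h
      have : (k₀ : ℝ) + 1 ≤ (k₁ - k₂ : ℤ) := by exact_mod_cast (by omega : k₀ + 1 ≤ k₁ - k₂)
      linarith
    have h2 : -k₀ ≤ k₁ - k₂ := by
      by_contra h
      have : ((k₁ - k₂ : ℤ) : ℝ) + 1 ≤ -k₀ := by exact_mod_cast (by omega : k₁ - k₂ + 1 ≤ -k₀)
      linarith
    have h1' : ((k₁ - k₂ : ℤ) : ℝ) ≤ k₀ := by exact_mod_cast h1
    have h2' : -(k₀ : ℝ) ≤ ((k₁ - k₂ : ℤ) : ℝ) := by exact_mod_cast h2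
    rw [abs_le]
    constructor <;> linarith
  refine ⟨k₁ - k₂, ?_, ?_⟩
  · rw [abs_div, abs_of_pos (by norm_num : (0 : ℝ) < 2)] at hkk
    linarith
  set K := ((k₁ - k₂ : ℤ) : ℝ) with hK
  have hC : K / 2 = K / (2 * t) * t := by field_simp
  have hC1 : (K / (2 * t)) ^ 2 ≤ 1 := by
    rw [sq_le_one_iff_abs_le_one]
    have h1 := abs_mul (K / (2 * t)) t
    rw [← hC, abs_of_pos ht0] at h1
    by_contra h
    nlinarith
  refine abs_asymptote_le hs rfl hs2 (abs_nonneg _) hz0 ?_ (norm_nonneg _) (norm_nonneg _)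
    (ea.trans ?_) eb hAB hfar'.le hκ hkk hC (Real.sqrt_nonneg _) (Real.sq_sqrt (by linarith))
  · rw [← Complex.normSq_eq_norm_sq, Complex.normSq_apply, sq_abs]
    ring
  · rw [sub_neg_eq_add]

/-- A set with Bessel distances containing the points `± s² / 2`, whose distances are at least
`s² / 2`, has `O(s²)` elements. -/
lemma HasBesselDistances.card_le {F : Finset ℂ} (hS : HasBesselDistances (F : Set ℂ)) {s : ℝ}
    (hs : 0 < s) (ha : ((-(s ^ 2 / 2) : ℝ) : ℂ) ∈ F) (hb : ((s ^ 2 / 2 : ℝ) : ℂ) ∈ F)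
    (hsep : ∀ z ∈ F, ∀ w ∈ F, z ≠ w → s ^ 2 / 2 ≤ ‖z - w‖) :
    (F.card : ℝ) ≤ 2000 * s ^ 2 := by
  have hs2 : 1 / 2 ≤ s ^ 2 := by
    have h := (hS _ ha _ hb (by
      intro h
      have := Complex.ofReal_injective h
      nlinarith)).1
    rw [← Complex.ofReal_sub, Complex.norm_real, Real.norm_eq_abs, abs_sub_comm,
      abs_of_nonneg (by nlinarith)] at h
    linarith
  have hnear : ((F.filter fun z => ‖z‖ ≤ 2 * s ^ 3).card : ℝ) ≤ 400 * s ^ 2 := by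
    refine (card_le_of_separated (σ := s ^ 2 / 2) (R := 2 * s ^ 3) (by positivity) (by positivity) _
      (fun z hz w hw => hsep z (Finset.mem_filter.1 hz).1 w (Finset.mem_filter.1 hw).1)
      (fun z hz => ⟨(Complex.abs_re_le_norm z).trans (Finset.mem_filter.1 hz).2,
        (Complex.abs_im_le_norm z).trans (Finset.mem_filter.1 hz).2⟩)).trans ?_
    have h1 : 4 * (2 * s ^ 3) / (s ^ 2 / 2) + 2 = 16 * s + 2 := by field_simp; ring
    rw [h1]
    have h2 : 1 / 2 ≤ s := by
      by_contra h
      nlinarith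
    nlinarith
  set G := F.filter fun z => ¬ ‖z‖ ≤ 2 * s ^ 3 with hG
  have hGF : ∀ z ∈ G, z ∈ F ∧ 2 * s ^ 3 < ‖z‖ := fun z hz =>
    ⟨(Finset.mem_filter.1 hz).1, not_le.1 (Finset.mem_filter.1 hz).2⟩
  have hex : ∀ z : ℂ, ∃ k : ℤ, z ∈ G → |(k : ℝ)| ≤ 2 * s ^ 2 ∧
      |(√(1 - (k / (2 * s ^ 2)) ^ 2) * z.re - k / (2 * s ^ 2) * |z.im|)| ≤ 2 * s := by
    intro z
    by_cases hz : z ∈ G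
    · obtain ⟨k, hk⟩ := hS.exists_asymptote hs ha hb hs2 (hGF z hz).1 (hGF z hz).2
      exact ⟨k, fun _ => hk⟩
    · exact ⟨0, fun h => absurd h hz⟩
  choose k hk using hex
  set w : ℤ → ℂ → ℝ := fun k z =>
    √(1 - (k / (2 * s ^ 2)) ^ 2) * z.re - k / (2 * s ^ 2) * |z.im| with hw
  set f : ℂ → (ℤ × ℤ) × Bool := fun z =>
    ((k z, ⌊w (k z) z / (s / 10)⌋), decide (0 ≤ z.im)) with hf
  set T : Finset ((ℤ × ℤ) × Bool) :=
    (Finset.Icc ⌊-(2 * s ^ 2)⌋ ⌊2 * s ^ 2⌋ ×ˢ Finset.Icc (-20) 20) ×ˢ Finset.univ with hT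
  have hmaps : ∀ z ∈ G, f z ∈ T := by
    intro z hz
    obtain ⟨h1, h2⟩ := hk z hz
    rw [abs_le] at h1 h2
    simp only [hf, hT, Finset.mem_product, Finset.mem_Icc, Finset.mem_univ, and_true]
    refine ⟨⟨?_, ?_⟩, ?_, ?_⟩
    · exact_mod_cast (Int.floor_le _).trans h1.1
    · exact Int.le_floor.2 h1.2
    · rw [Int.le_floor, le_div_iff₀ (by positivity)]
      push_cast; linarith [h2.1]
    · rw [Int.floor_le_iff, div_lt_iff₀ (by positivity)]
      push_cast; linarith [h2.2]
  have hfib : ∀ c ∈ T, (G.filter fun z => f z = c).card ≤ 2 := by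
    intro c _
    by_contra hc
    obtain ⟨z₁, z₂, z₃, h₁, h₂, h₃, h₁₂, h₁₃, h₂₃⟩ := Finset.two_lt_card_iff.1 (not_le.1 hc)
    set v : ℂ → ℝ := fun z =>
      c.1.1 / (2 * s ^ 2) * z.re + √(1 - (c.1.1 / (2 * s ^ 2)) ^ 2) * |z.im| with hv
    have hmem : ∀ z ∈ ({z₁, z₂, z₃} : Set ℂ), z ∈ G ∧ f z = c := by
      intro z hz
      simp only [Set.mem_insert_iff, Set.mem_singleton_iff] at hz
      rcases hz with rfl | rfl | rfl
      · exact Finset.mem_filter.1 h₁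
      · exact Finset.mem_filter.1 h₂
      · exact Finset.mem_filter.1 h₃
    have hcle : (c.1.1 / (2 * s ^ 2) : ℝ) ^ 2 ≤ 1 := by
      obtain ⟨hzG, hzc⟩ := hmem z₁ (by simp)
      have h1 := (hk z₁ hzG).1
      rw [show k z₁ = c.1.1 by rw [← hzc]] at h1
      rw [sq_le_one_iff_abs_le_one, abs_div, abs_of_pos (by positivity : 0 < 2 * s ^ 2)]
      exact (div_le_one (by positivity)).2 h1
    refine hS.false_of_thin (σ := s ^ 2 / 2) (by positivity) hsep v (w c.1.1)
      (hGF _ (hmem z₁ (by simp)).1).1 (hGF _ (hmem z₂ (by simp)).1).1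
      (hGF _ (hmem z₃ (by simp)).1).1 h₁₂ h₂₃ h₁₃ ?_ ?_
    · intro z hz z' hz'
      have h1 : decide (0 ≤ z.im) = decide (0 ≤ z'.im) := by
        have := congrArg Prod.snd ((hmem z hz).2.trans (hmem z' hz').2.symm)
        simpa [hf] using this
      have h2 : (|z.im| - |z'.im|) ^ 2 = (z.im - z'.im) ^ 2 := by
        rw [decide_eq_decide] at h1
        by_cases h : 0 ≤ z.im
        · rw [abs_of_nonneg h, abs_of_nonneg (h1.1 h)]
        · have h' : ¬ 0 ≤ z'.im := fun hh => h (h1.2 hh)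
          rw [abs_of_neg (not_le.1 h), abs_of_neg (not_le.1 h')]
          ring
      have h3 : √(1 - (c.1.1 / (2 * s ^ 2)) ^ 2) ^ 2 = 1 - (c.1.1 / (2 * s ^ 2) : ℝ) ^ 2 :=
        Real.sq_sqrt (by linarith)
      rw [← Complex.normSq_eq_norm_sq, Complex.normSq_apply]
      simp only [hv, hw, sub_re, sub_im]
      linear_combination (-1 : ℝ) * h2 - ((z.re - z'.re) ^ 2 + (|z.im| - |z'.im|) ^ 2) * h3
    · intro z hz z' hz'
      have h1 := congrArg (fun c => c.1.2) ((hmem z hz).2.trans (hmem z' hz').2.symm)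
      have hkz : k z = c.1.1 := by rw [← (hmem z hz).2]
      have hkz' : k z' = c.1.1 := by rw [← (hmem z' hz').2]
      simp only [hf, hkz, hkz'] at h1
      have h2 := abs_sub_lt_of_floor_eq (by positivity) h1
      have h3 := sq_lt_sq' (by linarith [(abs_lt.1 h2).1]) (abs_lt.1 h2).2
      nlinarith
  have hfar : (G.card : ℝ) ≤ 2 * T.card := by
    exact_mod_cast Finset.card_le_mul_card_image_of_maps_to hmaps 2 hfib
  have hTcard : (T.card : ℝ) ≤ (4 * s ^ 2 + 2) * 82 := by
    have h1 := card_Icc_floor_le (α := -(2 * s ^ 2)) (β := 2 * s ^ 2) (by nlinarith)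
    have h2 : (Finset.Icc (-20 : ℤ) 20).card = 41 := rfl
    rw [hT, Finset.card_product, Finset.card_product, h2, Finset.card_univ, Fintype.card_bool]
    push_cast
    linarith
  have hsum : (F.card : ℝ) = (F.filter fun z => ‖z‖ ≤ 2 * s ^ 3).card + G.card := by
    rw [hG]
    exact_mod_cast (Finset.card_filter_add_card_filter_not _).symm
  rw [hsum]
  nlinarith

lemma norm_sub_eq_euc2 (v w : Fin 2 → ℝ) : ‖(⟨v 0, v 1⟩ : ℂ) - ⟨w 0, w 1⟩‖ = euc2 (v - w) := by
  rw [Complex.norm_def, Complex.normSq_apply, euc2]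
  congr 1
  simp only [sub_re, sub_im, Pi.sub_apply]
  ring

lemma euc2_sub_pos {v w : Fin 2 → ℝ} (h : v ≠ w) : 0 < euc2 (v - w) := by
  rw [← norm_sub_eq_euc2, norm_pos_iff, sub_ne_zero]
  intro h'
  rw [Complex.mk.injEq] at h'
  refine h (funext fun i => ?_)
  fin_cases i
  exacts [h'.1, h'.2]

/-- A finite orthogonal set for the disk in which the distance of `a` and `b` is at most twice the
minimal distance has `O(|a - b|)` elements. -/
lemma card_le_of_ftDisk_eq_zero {F : Finset (Fin 2 → ℝ)}
    (hF : ∀ l ∈ F, ∀ m ∈ F, l ≠ m → ftDisk (l - m) = 0) {a b : Fin 2 → ℝ} (ha : a ∈ F) (hb : b ∈ F)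
    (hab : a ≠ b) (hsep : ∀ l ∈ F, ∀ m ∈ F, l ≠ m → euc2 (a - b) / 2 ≤ euc2 (l - m)) :
    (F.card : ℝ) ≤ 2000 * euc2 (a - b) := by
  have ht := euc2_sub_pos hab
  set t := euc2 (a - b)
  have hd : ‖(⟨b 0, b 1⟩ : ℂ) - ⟨a 0, a 1⟩‖ = t := by rw [norm_sub_rev, norm_sub_eq_euc2]
  set d : ℂ := (⟨b 0, b 1⟩ : ℂ) - ⟨a 0, a 1⟩ with hd'
  have htC : (t : ℂ) ≠ 0 := by exact_mod_cast ht.ne'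
  set u : ℂ := (starRingEnd ℂ) d / t with hu
  have hu1 : ‖u‖ = 1 := by
    rw [hu, norm_div, Complex.norm_conj, Complex.norm_real, Real.norm_of_nonneg ht.le, hd,
      div_self ht.ne']
  have hud : u * d = t := by
    rw [hu, div_mul_eq_mul_div, mul_comm, Complex.mul_conj, Complex.normSq_eq_norm_sq, hd]
    push_cast
    field_simp
  set g : (Fin 2 → ℝ) → ℂ :=
    fun v => u * (⟨v 0, v 1⟩ - ((⟨a 0, a 1⟩ : ℂ) + ⟨b 0, b 1⟩) / 2) with hg
  have hiso : ∀ v w, ‖g v - g w‖ = euc2 (v - w) := by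
    intro v w
    rw [← norm_sub_eq_euc2, hg]
    simp only
    rw [← mul_sub, norm_mul, hu1, one_mul, sub_sub_sub_cancel_right]
  have hinj : Function.Injective g := by
    intro v w hvw
    by_contra hne
    have := hiso v w
    rw [hvw, sub_self, norm_zero] at this
    exact (euc2_sub_pos hne).ne this
  have hbes : HasBesselDistances ((F.image g : Finset ℂ) : Set ℂ) := by
    intro z hz w hw hzw
    obtain ⟨l, hl, rfl⟩ := Finset.mem_image.1 (Finset.mem_coe.1 hz)
    obtain ⟨m, hm, rfl⟩ := Finset.mem_image.1 (Finset.mem_coe.1 hw)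
    have hlm : l ≠ m := fun h => hzw (congrArg g h)
    rw [hiso]
    exact euc2_of_ftDisk_eq_zero (euc2_sub_pos hlm) (hF l hl m hm hlm)
  have hs : √t ^ 2 = t := Real.sq_sqrt ht.le
  have hga : g a = ((-(√t ^ 2 / 2) : ℝ) : ℂ) := by
    rw [hs]
    push_cast
    rw [← hud, hg, hd']
    ring
  have hgb : g b = ((√t ^ 2 / 2 : ℝ) : ℂ) := by
    rw [hs]
    push_cast
    rw [← hud, hg, hd']
    ring
  have key := hbes.card_le (s := √t) (Real.sqrt_pos.2 ht) (hga ▸ Finset.mem_image_of_mem g ha)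
    (hgb ▸ Finset.mem_image_of_mem g hb) (by
      intro z hz w hw hzw
      obtain ⟨l, hl, rfl⟩ := Finset.mem_image.1 hz
      obtain ⟨m, hm, rfl⟩ := Finset.mem_image.1 hw
      rw [hiso, hs]
      exact hsep l hl m hm fun h => hzw (congrArg g h))
  rwa [Finset.card_image_of_injective _ hinj, hs] at key

/-- The minimal distance of the points of `Λ`. -/
noncomputable def minGap (Λ : Set (Fin 2 → ℝ)) : ℝ :=
  sInf {r : ℝ | ∃ l ∈ Λ, ∃ m ∈ Λ, l ≠ m ∧ r = euc2 (l - m)}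

lemma minGap_le {Λ : Set (Fin 2 → ℝ)} {l m : Fin 2 → ℝ} (hl : l ∈ Λ) (hm : m ∈ Λ) (hlm : l ≠ m) :
    minGap Λ ≤ euc2 (l - m) := by
  refine csInf_le ⟨0, ?_⟩ ⟨l, hl, m, hm, hlm, rfl⟩
  rintro _ ⟨l, -, m, -, -, rfl⟩
  exact Real.sqrt_nonneg _

lemma minGap_pos {Λ : Set (Fin 2 → ℝ)} (hΛ : ∀ l ∈ Λ, ∀ m ∈ Λ, l ≠ m → ftDisk (l - m) = 0)
    (hnt : Λ.Nontrivial) : 0 < minGap Λ := by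
  obtain ⟨a, ha, b, hb, hab⟩ := hnt
  refine lt_of_lt_of_le (by norm_num : (0 : ℝ) < 1 / 2) (le_csInf ⟨_, a, ha, b, hb, hab, rfl⟩ ?_)
  rintro _ ⟨l, hl, m, hm, hlm, rfl⟩
  exact (euc2_of_ftDisk_eq_zero (euc2_sub_pos hlm) (hΛ l hl m hm hlm)).1

/-- An orthogonal set for the disk is finite, of size bounded linearly in its minimal distance. -/
lemma finite_and_ncard_le_minGap {Λ : Set (Fin 2 → ℝ)}
    (hΛ : ∀ l ∈ Λ, ∀ m ∈ Λ, l ≠ m → ftDisk (l - m) = 0) (hnt : Λ.Nontrivial) :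
    Λ.Finite ∧ (Λ.ncard : ℝ) ≤ 4000 * minGap Λ := by
  have hpos := minGap_pos hΛ hnt
  have hne : {r : ℝ | ∃ l ∈ Λ, ∃ m ∈ Λ, l ≠ m ∧ r = euc2 (l - m)}.Nonempty := by
    obtain ⟨a, ha, b, hb, hab⟩ := hnt
    exact ⟨_, a, ha, b, hb, hab, rfl⟩
  obtain ⟨_, ⟨a, ha, b, hb, hab, rfl⟩, hlt⟩ :=
    exists_lt_of_csInf_lt hne (show minGap Λ < 2 * minGap Λ by linarith)
  have hcard : ∀ F : Finset (Fin 2 → ℝ), (F : Set (Fin 2 → ℝ)) ⊆ Λ →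
      (F.card : ℝ) ≤ 4000 * minGap Λ := by
    intro F hFΛ
    have hsub : ∀ l ∈ insert a (insert b F), l ∈ Λ := by
      intro l hl
      simp only [Finset.mem_insert] at hl
      rcases hl with rfl | rfl | hl
      exacts [ha, hb, hFΛ hl]
    have h1 := card_le_of_ftDisk_eq_zero (F := insert a (insert b F))
      (fun l hl m hm => hΛ l (hsub l hl) m (hsub m hm)) (by simp) (by simp) hab
      (fun l hl m hm hlm => by linarith [minGap_le (hsub l hl) (hsub m hm) hlm])
    have h2 : (F.card : ℝ) ≤ (insert a (insert b F)).card := by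
      exact_mod_cast Finset.card_le_card ((Finset.subset_insert _ _).trans (Finset.subset_insert _ _))
    linarith
  have hfin : Λ.Finite := by
    by_contra hinf
    obtain ⟨n, hn⟩ := exists_nat_gt (4000 * minGap Λ)
    obtain ⟨F, hFΛ, hFn⟩ := Set.Infinite.exists_subset_card_eq hinf n
    have := hcard F hFΛ
    rw [hFn] at this
    linarith
  refine ⟨hfin, ?_⟩
  rw [Set.ncard_eq_toFinset_card Λ hfin]
  exact hcard _ (by simp)

/-- Packing: a finite set with positive minimal distance in a square. -/
lemma ncard_le_of_minGap {Q : Set (Fin 2 → ℝ)} (hfin : Q.Finite) (hnt : Q.Nontrivial)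
    (hpos : 0 < minGap Q) {R : ℝ} (hR : 0 < R) (hQ : ∀ x ∈ Q, ∀ i, |x i| ≤ R) :
    (Q.ncard : ℝ) * minGap Q ^ 2 ≤ 100 * R ^ 2 := by
  have hle : minGap Q ≤ 3 * R := by
    obtain ⟨a, ha, b, hb, hab⟩ := hnt
    refine (minGap_le ha hb hab).trans (Real.sqrt_le_iff.2 ⟨by positivity, ?_⟩)
    have h : ∀ i, ((a - b) i) ^ 2 ≤ (2 * R) ^ 2 := by
      intro i
      have h1 := abs_le.1 (hQ a ha i)
      have h2 := abs_le.1 (hQ b hb i)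
      rw [Pi.sub_apply]
      exact sq_le_sq' (by linarith) (by linarith)
    nlinarith [h 0, h 1]
  have hinj : Function.Injective fun v : Fin 2 → ℝ => (⟨v 0, v 1⟩ : ℂ) := by
    intro v w hvw
    by_contra hne
    have := norm_sub_eq_euc2 v w
    simp only at hvw
    rw [hvw, sub_self, norm_zero] at this
    exact (euc2_sub_pos hne).ne this
  have h := card_le_of_separated hpos hR.le
    (hfin.toFinset.image fun v : Fin 2 → ℝ => (⟨v 0, v 1⟩ : ℂ)) (by
      intro z hz w hw hzw
      obtain ⟨l, hl, rfl⟩ := Finset.mem_image.1 hz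
      obtain ⟨m, hm, rfl⟩ := Finset.mem_image.1 hw
      rw [norm_sub_eq_euc2]
      exact minGap_le (hfin.mem_toFinset.1 hl) (hfin.mem_toFinset.1 hm) fun h => hzw (by rw [h])) (by
      intro z hz
      obtain ⟨l, hl, rfl⟩ := Finset.mem_image.1 hz
      exact ⟨hQ l (hfin.mem_toFinset.1 hl) 0, hQ l (hfin.mem_toFinset.1 hl) 1⟩)
  rw [Finset.card_image_of_injective _ hinj, ← Set.ncard_eq_toFinset_card Q hfin] at h
  calc (Q.ncard : ℝ) * minGap Q ^ 2 ≤ (4 * R / minGap Q + 2) ^ 2 * minGap Q ^ 2 := by gcongr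
    _ = (4 * R + 2 * minGap Q) ^ 2 := by field_simp
    _ ≤ (10 * R) ^ 2 := by gcongr; linarith
    _ = _ := by ring

lemma le_mul_rpow_of_pow_three_le {N R c : ℝ} (hR : 0 ≤ R) (hc : 0 ≤ c)
    (h : N ^ 3 ≤ c ^ 3 * R ^ 2) : N ≤ c * R ^ ((2 : ℝ) / 3) := by
  refine le_of_pow_le_pow_left₀ three_ne_zero (by positivity) (h.trans (le_of_eq ?_))
  rw [mul_pow, ← Real.rpow_natCast (R ^ ((2 : ℝ) / 3)) 3, ← Real.rpow_mul hR]
  norm_num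

/-- Bounds on orthogonal sets of exponentials for the disk: there are absolute constants
`C₁, C₂ > 0` such that any set `Λ` with at least two elements which is orthogonal for the
unit disk is finite with `|Λ| ≤ C₁ t`, where `t` is the minimal gap of `Λ`, and satisfies
`|Λ ∩ [−R, R]²| ≤ C₂ R^{2/3}` for all `R ≥ 1`. -/
theorem disk_orthogonal_sets_bound :
    ∃ C₁ : ℝ, 0 < C₁ ∧ ∃ C₂ : ℝ, 0 < C₂ ∧
      ∀ Λ : Set (Fin 2 → ℝ),
        (∀ l ∈ Λ, ∀ m ∈ Λ, l ≠ m → ftDisk (l - m) = 0) →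
        Λ.Nontrivial →
        Λ.Finite ∧
        (Λ.ncard : ℝ) ≤
          C₁ * sInf {r : ℝ | ∃ l ∈ Λ, ∃ m ∈ Λ, l ≠ m ∧ r = euc2 (l - m)} ∧
        ∀ R : ℝ, 1 ≤ R →
          ((Λ ∩ {x : Fin 2 → ℝ | ∀ i, |x i| ≤ R}).ncard : ℝ) ≤ C₂ * R ^ ((2 : ℝ) / 3) := by
  refine ⟨4000, by norm_num, 2000, by norm_num, fun Λ hΛ hnt => ?_⟩
  obtain ⟨hfin, hcard⟩ := finite_and_ncard_le_minGap hΛ hnt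
  refine ⟨hfin, hcard, fun R hR => le_mul_rpow_of_pow_three_le (by linarith) (by norm_num) ?_⟩
  set Q := Λ ∩ {x : Fin 2 → ℝ | ∀ i, |x i| ≤ R} with hQ
  have hQΛ : ∀ l ∈ Q, ∀ m ∈ Q, l ≠ m → ftDisk (l - m) = 0 := fun l hl m hm => hΛ l hl.1 m hm.1
  by_cases hQnt : Q.Nontrivial
  · obtain ⟨hQfin, hQcard⟩ := finite_and_ncard_le_minGap hQΛ hQnt
    have h1 := ncard_le_of_minGap hQfin hQnt (minGap_pos hQΛ hQnt) (by linarith : 0 < R)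
      fun x hx => hx.2
    have h2 : (Q.ncard : ℝ) ^ 2 ≤ (4000 * minGap Q) ^ 2 := by gcongr
    have h3 := mul_le_mul_of_nonneg_left h2 (Nat.cast_nonneg (α := ℝ) Q.ncard)
    nlinarith
  · have h1 : (Q.ncard : ℝ) ≤ 1 := by
      have : Finite Q := hfin.inter_of_left _
      exact_mod_cast Set.ncard_le_one_iff_subsingleton.2 (Set.not_nontrivial_iff.1 hQnt)
    have h2 : (Q.ncard : ℝ) ^ 3 ≤ 1 := pow_le_one₀ (Nat.cast_nonneg _) h1
    nlinarith
end
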